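/- arXiv:2007.15772 — 3 statements merged into one kernel-verified Lean document; each statement's English description precedes it below -/
import Mathlib

section
/- Let R be a Noetherian local ring with maximal ideal m and residue field K, essentially of finite type over a field k, and assume the extension k ⊆ K is separable. Then the minimal number of generators of Ω_{R/k} equals edim R + trdeg_k K, where edim R = dim_K(m/m²) is the embedding dimension. -/
noncomputable section

/-- The minimal number of generators of an `R`-module `M`. -/
def minGens (R M : Type) [Semiring R] [AddCommMonoid M] [Module R M] : ℕ :=
  sInf {n | ∃ s : Finset M, s.card = n ∧ Submodule.span R (s : Set M) = ⊤}

/-- The embedding dimension of a local ring: the minimal number of generators of its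
maximal ideal. -/
def embDim (A : Type) [CommRing A] [IsLocalRing A] : ℕ :=
  sInf {n | ∃ s : Finset A, s.card = n ∧ Ideal.span (s : Set A) = IsLocalRing.maximalIdeal A}

theorem minGens_eq_spanFinrank (R M : Type) [Semiring R] [AddCommMonoid M] [Module R M] :
    minGens R M = (⊤ : Submodule R M).spanFinrank := by
  rw [Submodule.spanFinrank_eq_iInf, iInf, minGens]
  congr 1
  ext n
  simp [and_comm]

theorem embDim_eq_finrank_cotangentSpace (A : Type) [CommRing A] [IsLocalRing A]
    [IsNoetherianRing A] :
    embDim A =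
      Module.finrank (IsLocalRing.ResidueField A) (IsLocalRing.CotangentSpace A) := by
  rw [← IsLocalRing.spanFinrank_maximalIdeal_eq_finrank_cotangentSpace,
    Submodule.spanFinrank_eq_iInf, iInf, embDim]
  congr 1
  ext n
  simp [and_comm, Ideal.span]

open scoped TensorProduct in
theorem minGens_eq_finrank_residueField_tensor (R M : Type) [CommRing R] [IsLocalRing R]
    [AddCommGroup M] [Module R M] [Module.Finite R M] :
    minGens R M = Module.finrank (IsLocalRing.ResidueField R)
      (IsLocalRing.ResidueField R ⊗[R] M) := by
  rw [minGens_eq_spanFinrank,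
    ← TensorProduct.spanFinrank_top_eq_of_residueField _ Module.Finite.fg_top,
    ← Module.finrank_eq_spanFinrank_of_free]
  exact (Submodule.topEquiv.baseChange R (IsLocalRing.ResidueField R) _ _).finrank_eq

open scoped IntermediateField.algebraAdjoinAdjoin in
theorem finrank_kaehlerDifferential_of_isSeparable {k K ι : Type*} [Field k] [Field K]
    [Algebra k K] [Fintype ι] {y : ι → K} (hy : AlgebraicIndependent k y)
    [Algebra.IsSeparable (IntermediateField.adjoin k (Set.range y)) K] :
    Module.finrank K (Ω[K⁄k]) = Fintype.card ι := by
  let A := Algebra.adjoin k (Set.range y)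
  let F := IntermediateField.adjoin k (Set.range y)
  let : Algebra (MvPolynomial ι k) A := hy.aevalEquiv.toAlgHom.toAlgebra
  let : Algebra (MvPolynomial ι k) K := (MvPolynomial.aeval y).toAlgebra
  have : IsScalarTower k (MvPolynomial ι k) K :=
    .of_algebraMap_eq' (MvPolynomial.aeval y).comp_algebraMap.symm
  have : IsScalarTower (MvPolynomial ι k) A K := .of_algebraMap_eq fun p ↦
    (hy.algebraMap_aevalEquiv p).symm
  have : Algebra.FormallyEtale (MvPolynomial ι k) A :=
    .of_equiv (AlgEquiv.ofBijective (Algebra.ofId _ A) hy.aevalEquiv.bijective)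
  have : Algebra.FormallyEtale A F := .of_isLocalization (nonZeroDivisors A)
  have : Algebra.FormallyEtale F K := .of_isSeparable F K
  have : Algebra.FormallyEtale A K := .comp A F K
  have : Algebra.FormallyEtale (MvPolynomial ι k) K := .comp _ A K
  rw [← (KaehlerDifferential.tensorKaehlerEquivOfFormallyEtale k
      (MvPolynomial ι k) K).finrank_eq, Module.finrank_eq_card_basis
    ((KaehlerDifferential.mvPolynomialBasis k ι).baseChange K)]

theorem kerCotangentToTensor_injective_of_formallySmooth (R P S : Type*) [CommRing R]
    [CommRing P] [CommRing S] [Algebra R P] [Algebra P S] [Algebra R S] [IsScalarTower R P S]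
    [Algebra.FormallySmooth R S] (hf : Function.Surjective (algebraMap P S)) :
    Function.Injective (KaehlerDifferential.kerCotangentToTensor R P S) := by
  let f := (IsScalarTower.toAlgHom R P S).kerSquareLift
  have hfs : Function.Surjective f := fun x ↦ by
    obtain ⟨p, rfl⟩ := hf x
    exact ⟨Ideal.Quotient.mk _ p, rfl⟩
  have hker : IsNilpotent (RingHom.ker f.toRingHom) := by
    refine ⟨2, ?_⟩
    change RingHom.ker f.toRingHom ^ 2 = ⊥
    rw [AlgHom.ker_kerSquareLift, Ideal.cotangentIdeal_square]
  obtain ⟨g, hg⟩ : ∃ g, f.comp g = AlgHom.id R S :=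
    ⟨_, Algebra.FormallySmooth.comp_liftOfSurjective (AlgHom.id R S) f hfs hker⟩
  obtain ⟨l, hl⟩ := (retractionKerCotangentToTensorEquivSection (R := R) hf).symm ⟨g, hg⟩
  exact Function.LeftInverse.injective (g := l) (LinearMap.congr_fun hl)

open scoped TensorProduct in
theorem finrank_residueField_tensor_kaehlerDifferential (k R : Type*) [Field k] [CommRing R]
    [IsLocalRing R] [IsNoetherianRing R] [Algebra k R] [Algebra.EssFiniteType k R]
    [Algebra k (IsLocalRing.ResidueField R)] [IsScalarTower k R (IsLocalRing.ResidueField R)]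
    [Algebra.FormallySmooth k (IsLocalRing.ResidueField R)] :
    Module.finrank (IsLocalRing.ResidueField R) (IsLocalRing.ResidueField R ⊗[R] Ω[R⁄k]) =
      Module.finrank (IsLocalRing.ResidueField R) (IsLocalRing.CotangentSpace R) +
        Module.finrank (IsLocalRing.ResidueField R) (Ω[IsLocalRing.ResidueField R⁄k]) := by
  have hf : Function.Surjective (algebraMap R (IsLocalRing.ResidueField R)) :=
    IsLocalRing.residue_surjective
  have hker : IsLocalRing.maximalIdeal R =
      RingHom.ker (algebraMap R (IsLocalRing.ResidueField R)) := IsLocalRing.ker_residue.symm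
  let e := Ideal.Cotangent.equivOfEq _ _ hker
  let c := KaehlerDifferential.kerCotangentToTensor k R (IsLocalRing.ResidueField R)
  let i : IsLocalRing.CotangentSpace R →ₗ[IsLocalRing.ResidueField R]
      IsLocalRing.ResidueField R ⊗[R] Ω[R⁄k] :=
    (c ∘ₗ e.toLinearMap).extendScalarsOfSurjective hf
  let p := KaehlerDifferential.mapBaseChange k R (IsLocalRing.ResidueField R)
  have hi : Function.Injective i :=
    (kerCotangentToTensor_injective_of_formallySmooth k R _ hf).comp e.injective
  have hp : Function.Surjective p := KaehlerDifferential.mapBaseChange_surjective k R _ hf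
  have hip : LinearMap.range i = LinearMap.ker p := by
    ext x
    rw [LinearMap.mem_ker,
      KaehlerDifferential.exact_kerCotangentToTensor_mapBaseChange k R _ hf x]
    exact (e.surjective.exists (p := fun y ↦ c y = x)).symm
  rw [← p.finrank_range_add_finrank_ker, LinearMap.range_eq_top.mpr hp, finrank_top, ← hip,
    LinearMap.finrank_range_of_inj hi, add_comm]

/-- The minimal number of generators of the module of Kähler differentials of a Noetherian
local ring essentially of finite type over `k`, with separable residue field extension,
equals the embedding dimension plus the transcendence degree of the residue field. -/
theorem minGens_kaehler (k R : Type) [Field k] [CommRing R] [IsLocalRing R]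
    [IsNoetherianRing R] [Algebra k R] [Algebra.EssFiniteType k R]
    [Algebra k (IsLocalRing.ResidueField R)]
    [IsScalarTower k R (IsLocalRing.ResidueField R)]
    (t : ℕ) (y : Fin t → IsLocalRing.ResidueField R)
    (hy : IsTranscendenceBasis k y)
    (hsep : Algebra.IsSeparable (↥(IntermediateField.adjoin k (Set.range y)))
      (IsLocalRing.ResidueField R)) :
    minGens R (Ω[R⁄k]) = embDim R + t := by
  have : Algebra.FormallySmooth k (IsLocalRing.ResidueField R) :=
    .of_algebraicIndependent_of_isSeparable hy.1
  rw [minGens_eq_finrank_residueField_tensor, finrank_residueField_tensor_kaehlerDifferential,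
    finrank_kaehlerDifferential_of_isSeparable hy.1, Fintype.card_fin,
    embDim_eq_finrank_cotangentSpace]
end
end

section
/- Let R be a Noetherian ring and E a finite R-module with rank e and presentation R^s →^φ R^n → E → 0. Then the condition 'ht F_i(E) ≥ i − e + t + 1 for all i ≥ e' (where F_i(E) = I_{n−i}(φ) is the i-th Fitting ideal) holds if and only if μ(E_p) ≤ dim R_p + e − t for every prime p of R such that E_p is not free. -/
noncomputable section

/-- The height of an ideal: the infimum of the heights of the primes containing it. -/
def idealHeight {R : Type} [CommRing R] (I : Ideal R) : ℕ∞ :=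
  ⨅ (p : PrimeSpectrum R) (_ : I ≤ p.asIdeal), Order.height p

/-- The ideal of `t × t` minors of a matrix. -/
def minorsIdeal {R : Type} [CommRing R] {n m : Type} [Fintype n] [Fintype m]
    (M : Matrix n m R) (t : ℕ) : Ideal R :=
  Ideal.span { x | ∃ (f : Fin t → n) (g : Fin t → m), x = (M.submatrix f g).det }

/-- A module `M` has rank `e` if it is free of rank `e` locally at every associated
prime of `R`. -/
def hasRank (R M : Type) [CommRing R] [AddCommGroup M] [Module R M] (e : ℕ) : Prop :=
  ∀ (p : Ideal R) (hp : p.IsPrime), p ∈ associatedPrimes R R →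
    letI := hp
    Module.Free (Localization.AtPrime p) (LocalizedModule p.primeCompl M) ∧
      Module.finrank (Localization.AtPrime p) (LocalizedModule p.primeCompl M) = e

section Localization

variable {R M : Type*} [CommRing R] [AddCommGroup M] [Module R M] (S : Submonoid R)

theorem span_mkLinearMap_image_eq_top_iff (s : Set M) :
    Submodule.span (Localization S) (LocalizedModule.mkLinearMap S M '' s) = ⊤ ↔
      ∀ y : M, ∃ u ∈ S, u • y ∈ Submodule.span R s := by
  rw [← Submodule.localized'_span (Localization S) S, Submodule.eq_top_iff']
  simp only [Submodule.mem_localized']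
  constructor
  · intro h y
    obtain ⟨m, hm, t, ht⟩ := h (LocalizedModule.mkLinearMap S M y)
    rw [IsLocalizedModule.mk'_eq_iff, Submonoid.smul_def, ← map_smul,
      IsLocalizedModule.eq_iff_exists S] at ht
    obtain ⟨c, hc⟩ := ht
    refine ⟨c * t, S.mul_mem c.2 t.2, ?_⟩
    rw [mul_smul]
    change c • (t : R) • y ∈ _
    rw [← hc]
    exact Submodule.smul_mem _ (c : R) hm
  · intro h x
    obtain ⟨⟨y, t⟩, rfl⟩ := IsLocalizedModule.mk'_surjective S (LocalizedModule.mkLinearMap S M) x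
    obtain ⟨u, hu, hy⟩ := h y
    exact ⟨_, hy, ⟨u, hu⟩ * t, IsLocalizedModule.mk'_cancel_left _ y ⟨u, hu⟩ t⟩

theorem linearIndependent_mkLinearMap_iff {ι : Type*} [Fintype ι] (v : ι → M) :
    LinearIndependent (Localization S) (fun j => LocalizedModule.mkLinearMap S M (v j)) ↔
      ∀ c : ι → R, ∑ j, c j • v j = 0 → ∃ u ∈ S, ∀ j, u * c j = 0 := by
  classical
  rw [Fintype.linearIndependent_iff]
  constructor
  · intro h c hc
    have h0 := h (fun j => algebraMap R _ (c j)) (by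
      simp only [algebraMap_smul, ← map_smul, ← map_sum, hc, map_zero])
    choose u hu using fun j => (IsLocalization.map_eq_zero_iff S _ (c j)).1 (h0 j)
    refine ⟨∏ j, (u j : R), S.prod_mem fun j _ => (u j).2, fun j => ?_⟩
    rw [← Finset.prod_erase_mul _ _ (Finset.mem_univ j), mul_assoc, hu, mul_zero]
  · intro h c hc
    obtain ⟨b, hb⟩ := IsLocalization.exist_integer_multiples_of_finite S c
    choose a ha using hb
    have h1 : LocalizedModule.mkLinearMap S M (∑ j, a j • v j) = 0 := by
      rw [map_sum, ← smul_zero (b : R), ← hc, Finset.smul_sum]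
      refine Finset.sum_congr rfl fun j _ => ?_
      rw [← smul_assoc, ← ha j, map_smul, algebraMap_smul]
    obtain ⟨u, hu⟩ := (IsLocalizedModule.eq_zero_iff S _).1 h1
    obtain ⟨w, hw, hw'⟩ := h (fun j => u * a j) (by
      simpa only [Finset.smul_sum, Submonoid.smul_def, mul_smul] using hu)
    intro j
    have h2 : algebraMap R (Localization S) (a j) = 0 := by
      refine (IsLocalization.map_eq_zero_iff S _ _).2 ⟨⟨w, hw⟩ * u, ?_⟩
      simpa [mul_assoc] using hw' j
    rw [ha j, Algebra.smul_def] at h2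
    exact (IsLocalization.map_units (Localization S) b).mul_right_eq_zero.1 h2

theorem exists_units_smul_eq_mkLinearMap (x : LocalizedModule S M) :
    ∃ (u : (Localization S)ˣ) (y : M), u • x = LocalizedModule.mkLinearMap S M y := by
  obtain ⟨⟨y, t⟩, h⟩ := IsLocalizedModule.surj S (LocalizedModule.mkLinearMap S M) x
  refine ⟨(IsLocalization.map_units (Localization S) t).unit, y, ?_⟩
  rw [← h, Units.smul_def, IsUnit.unit_spec, algebraMap_smul]
  rfl

end Localization

section LocallyGenerated

variable {R M : Type*} [CommRing R] [AddCommGroup M] [Module R M]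

/-- The vectors `v` generate `M` up to multiplication by elements of the submonoid `S`. -/
def LocallySpans (S : Submonoid R) {ι : Type*} (v : ι → M) : Prop :=
  ∀ y : M, ∃ u ∈ S, u • y ∈ Submodule.span R (Set.range v)

/-- Linear relations between the vectors `v` vanish up to elements of the submonoid `S`. -/
def LocallyIndependent (S : Submonoid R) {ι : Type*} [Fintype ι] (v : ι → M) : Prop :=
  ∀ c : ι → R, ∑ j, c j • v j = 0 → ∃ u ∈ S, ∀ j, u * c j = 0

variable {S T : Submonoid R} {ι : Type*} {v : ι → M}

theorem LocallySpans.mono (h : LocallySpans S v) (hST : S ≤ T) : LocallySpans T v := fun y =>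
  let ⟨u, hu, hy⟩ := h y
  ⟨u, hST hu, hy⟩

theorem LocallyIndependent.mono [Fintype ι] (h : LocallyIndependent S v) (hST : S ≤ T) :
    LocallyIndependent T v := fun c hc =>
  let ⟨u, hu, hy⟩ := h c hc
  ⟨u, hST hu, hy⟩

theorem locallySpans_iff :
    LocallySpans S v ↔ Submodule.span (Localization S)
      (Set.range fun j => LocalizedModule.mkLinearMap S M (v j)) = ⊤ := by
  rw [LocallySpans, ← span_mkLinearMap_image_eq_top_iff, ← Set.range_comp]
  rfl

theorem LocallySpans.exists_basis [Fintype ι] (h : LocallySpans S v)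
    (h' : LocallyIndependent S v) :
    Nonempty (Module.Basis ι (Localization S) (LocalizedModule S M)) :=
  ⟨.mk ((linearIndependent_mkLinearMap_iff S v).2 h') (locallySpans_iff.1 h).ge⟩

theorem exists_locallySpans_of_basis [Fintype ι]
    (b : Module.Basis ι (Localization S) (LocalizedModule S M)) :
    ∃ v : ι → M, LocallySpans S v ∧ LocallyIndependent S v := by
  choose u v hv using fun j => exists_units_smul_eq_mkLinearMap S (b j)
  have hb : ⇑(b.unitsSMul u) = fun j => LocalizedModule.mkLinearMap S M (v j) := by
    funext j
    rw [Module.Basis.unitsSMul_apply, hv]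
  refine ⟨v, locallySpans_iff.2 ?_, (linearIndependent_mkLinearMap_iff S v).1 ?_⟩
  · rw [← hb, Module.Basis.span_eq]
  · rw [← hb]
    exact Module.Basis.linearIndependent _

theorem exists_fin_range_of_card_le {α : Type*} [Zero α] (s : Finset α) {i : ℕ}
    (hs : s.card ≤ i) : ∃ v : Fin i → α, (s : Set α) ⊆ Set.range v := by
  let e := s.equivFin
  refine ⟨fun k => if h : (k : ℕ) < s.card then e.symm ⟨k, h⟩ else 0, fun x hx => ?_⟩
  refine ⟨Fin.castLE hs (e ⟨x, hx⟩), ?_⟩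
  simp

end LocallyGenerated

section Minors

/-- A matrix over a field of rank at least `r` has an invertible `r × r` submatrix. -/
theorem Matrix.exists_det_submatrix_ne_zero_of_le_rank {K m n : Type*} [Field K] [Fintype m]
    [Fintype n] (A : Matrix m n K) {r : ℕ} (hr : r ≤ A.rank) :
    ∃ (f : Fin r → m) (c : Fin r → n), (A.submatrix f c).det ≠ 0 := by
  obtain ⟨w, hw, -, hli⟩ := Submodule.exists_fun_fin_finrank_span_eq K (Set.range A.row)
  choose f hf using hw
  rw [A.rank_eq_finrank_span_row] at hr
  let f' : Fin r → m := f ∘ Fin.castLE hr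
  have hrow : LinearIndependent K (A.submatrix f' id).row := by
    rw [show (A.submatrix f' id).row = w ∘ Fin.castLE hr from funext fun _ => hf _]
    exact hli.comp _ (Fin.castLE_injective hr)
  have hrank := hrow.rank_matrix
  rw [Matrix.rank_eq_finrank_span_cols, Fintype.card_fin] at hrank
  obtain ⟨w', hw', -, hli'⟩ :=
    Submodule.exists_fun_fin_finrank_span_eq K (Set.range (A.submatrix f' id).col)
  choose c hc using hw'
  refine ⟨f', c ∘ Fin.cast hrank.symm, ?_⟩
  have hcol : LinearIndependent K (A.submatrix f' (c ∘ Fin.cast hrank.symm)).col := by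
    rw [show (A.submatrix f' (c ∘ Fin.cast hrank.symm)).col = w' ∘ Fin.cast hrank.symm from
      funext fun _ => hc _]
    exact hli'.comp _ (Fin.cast_injective hrank.symm)
  rw [Matrix.linearIndependent_cols_iff_isUnit, Matrix.isUnit_iff_isUnit_det] at hcol
  exact hcol.ne_zero

theorem minorsIdeal_le_iff {R m n : Type} [CommRing R] [Fintype m] [Fintype n]
    (A : Matrix m n R) (r : ℕ) (p : Ideal R) :
    minorsIdeal A r ≤ p ↔
      ∀ (f : Fin r → m) (c : Fin r → n), (A.submatrix f c).det ∈ p := by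
  rw [minorsIdeal, Ideal.span_le]
  constructor
  · exact fun h f c => h ⟨f, c, rfl⟩
  · rintro h _ ⟨f, c, rfl⟩
    exact h f c

variable {R E : Type} [CommRing R] [AddCommGroup E] [Module R E] {n s : ℕ}
  {φ : Matrix (Fin n) (Fin s) R} {g : (Fin n → R) →ₗ[R] E}

theorem det_submatrix_smul_mem_span (hker : LinearMap.range φ.mulVecLin ≤ LinearMap.ker g)
    {r : ℕ} (f : Fin r → Fin n) (c : Fin r → Fin s) (j : Fin n) :
    (φ.submatrix f c).det • g (Pi.single j 1) ∈
      Submodule.span R ((fun k => g (Pi.single k 1)) '' (Set.range f)ᶜ) := by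
  classical
  set W := Submodule.span R ((fun k => g (Pi.single k 1)) '' (Set.range f)ᶜ) with hW
  by_cases hinj : Function.Injective f
  swap
  · rw [Function.not_injective_iff] at hinj
    obtain ⟨a, b, hab, hne⟩ := hinj
    rw [Matrix.det_zero_of_row_eq hne (by funext l; simp [hab]), zero_smul]
    exact W.zero_mem
  by_cases hj : j ∈ Set.range f
  swap
  · exact W.smul_mem _ (Submodule.subset_span ⟨j, hj, rfl⟩)
  obtain ⟨k, rfl⟩ := hj
  have hcol : ∀ l, ∑ k', φ (f k') (c l) • g (Pi.single (f k') 1) ∈ W := by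
    intro l
    have h0 : ∑ i, φ i (c l) • g (Pi.single i 1) = 0 := by
      have : g (φ.mulVecLin (Pi.single (c l) 1)) = 0 := hker ⟨_, rfl⟩
      rw [Matrix.mulVecLin_apply, Matrix.mulVec_single_one,
        pi_eq_sum_univ' (φ.col (c l)), map_sum] at this
      simpa using this
    rw [← Finset.sum_image (s := Finset.univ) (g := f)
      (f := fun i => φ i (c l) • g (Pi.single i 1)) (fun _ _ _ _ h => hinj h)]
    rw [← Finset.sum_add_sum_compl (Finset.univ.image f)] at h0
    rw [eq_neg_of_add_eq_zero_left h0]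
    refine W.neg_mem (W.sum_mem fun i hi => W.smul_mem _ (Submodule.subset_span ⟨i, ?_, rfl⟩))
    simpa using hi
  have h1 : ∑ l, (φ.submatrix f c).adjugate l k •
      ∑ k', φ (f k') (c l) • g (Pi.single (f k') 1) ∈ W :=
    W.sum_mem fun l _ => W.smul_mem _ (hcol l)
  convert h1 using 1
  simp_rw [Finset.smul_sum, smul_smul]
  rw [Finset.sum_comm]
  simp_rw [← Finset.sum_smul]
  have h2 : ∀ k', ∑ l, (φ.submatrix f c).adjugate l k * φ (f k') (c l) =
      if k' = k then (φ.submatrix f c).det else 0 := by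
    intro k'
    have := congrFun (congrFun (φ.submatrix f c).mul_adjugate k') k
    rw [Matrix.mul_apply] at this
    simpa [Matrix.one_apply, mul_comm] using this
  simp_rw [h2]
  simp

theorem exists_locallySpans_of_not_minorsIdeal_le (hg : Function.Surjective g)
    (hker : LinearMap.range φ.mulVecLin ≤ LinearMap.ker g) (p : Ideal R) [p.IsPrime] {i : ℕ}
    (h : ¬ minorsIdeal φ (n - i) ≤ p) :
    ∃ v : Fin i → E, LocallySpans p.primeCompl v := by
  classical
  rw [minorsIdeal_le_iff] at h
  push Not at h
  obtain ⟨f, c, hdet⟩ := h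
  have hinj : Function.Injective f := by
    by_contra hinj
    rw [Function.not_injective_iff] at hinj
    obtain ⟨a, b, hab, hne⟩ := hinj
    rw [Matrix.det_zero_of_row_eq hne (by funext l; simp [hab])] at hdet
    exact hdet p.zero_mem
  obtain ⟨v, hv⟩ := exists_fin_range_of_card_le (i := i)
    ((Finset.univ.image f)ᶜ.image fun k => g (Pi.single k 1)) (by
      refine Finset.card_image_le.trans ?_
      rw [Finset.card_compl, Finset.card_image_of_injective _ hinj]
      simp only [Finset.card_univ, Fintype.card_fin]
      omega)
  refine ⟨v, fun y => ⟨_, hdet, ?_⟩⟩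
  obtain ⟨w, rfl⟩ := hg y
  rw [pi_eq_sum_univ' w, map_sum, Finset.smul_sum]
  refine Submodule.sum_mem _ fun j _ => ?_
  rw [map_smul, smul_comm]
  refine Submodule.smul_mem _ _ (Submodule.span_mono ?_ (det_submatrix_smul_mem_span hker f c j))
  refine subset_trans (le_of_eq ?_) hv
  simp

theorem not_minorsIdeal_le_of_locallySpans (hg : Function.Surjective g)
    (hker : LinearMap.ker g ≤ LinearMap.range φ.mulVecLin) (p : Ideal R) [p.IsPrime] {i : ℕ}
    {v : Fin i → E} (hv : LocallySpans p.primeCompl v) :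
    ¬ minorsIdeal φ (n - i) ≤ p := by
  classical
  choose ψ hψ using fun k => hg (v k)
  have key : ∀ j : Fin n, ∃ u ∈ p.primeCompl, ∃ (a : Fin i → R) (b : Fin s → R),
      u • (Pi.single j 1 : Fin n → R) = (Matrix.of ψ).transpose.mulVec a + φ.mulVec b := by
    intro j
    obtain ⟨u, hu, hy⟩ := hv (g (Pi.single j 1))
    obtain ⟨a, ha⟩ := (Submodule.mem_span_range_iff_exists_fun R).1 hy
    have : u • (Pi.single j 1 : Fin n → R) - (Matrix.of ψ).transpose.mulVec a ∈ LinearMap.ker g := by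
      rw [LinearMap.mem_ker, map_sub, map_smul, ← ha, Matrix.mulVec_eq_sum, map_sum, sub_eq_zero]
      refine Finset.sum_congr rfl fun k _ => ?_
      simp [← hψ]
      rfl
    obtain ⟨b, hb⟩ := hker this
    refine ⟨u, hu, a, b, ?_⟩
    rw [← Matrix.mulVecLin_apply φ, hb, add_sub_cancel]
  let K := p.ResidueField
  let π : R →+* K := algebraMap R K
  have hπ : ∀ x, π x = 0 ↔ x ∈ p := fun x => Ideal.algebraMap_residueField_eq_zero
  have htop : LinearMap.range ((Matrix.of ψ).transpose.map π).mulVecLin ⊔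
      LinearMap.range (φ.map π).mulVecLin = ⊤ := by
    rw [eq_top_iff, ← (Pi.basisFun K (Fin n)).span_eq, Submodule.span_le]
    rintro _ ⟨j, rfl⟩
    obtain ⟨u, hu, a, b, h⟩ := key j
    have hu' : π u ≠ 0 := fun h => hu ((hπ u).1 h)
    have hcomb : π u • (Pi.single j 1 : Fin n → K) = ((Matrix.of ψ).transpose.map π).mulVec (π ∘ a) +
        (φ.map π).mulVec (π ∘ b) := by
      funext k
      have := congrArg π (congrFun h k)
      rw [Pi.add_apply, map_add, RingHom.map_mulVec, RingHom.map_mulVec] at this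
      rw [Pi.add_apply, ← this]
      by_cases hk : k = j
      · subst hk; simp
      · simp [hk]
    rw [SetLike.mem_coe, Pi.basisFun_apply, ← inv_smul_smul₀ hu' (Pi.single j 1), hcomb]
    exact Submodule.smul_mem _ _ (Submodule.add_mem_sup ⟨_, rfl⟩ ⟨_, rfl⟩)
  have hrank : n - i ≤ (φ.map π).rank := by
    have h1 := Submodule.finrank_add_le_finrank_add_finrank
      (LinearMap.range ((Matrix.of ψ).transpose.map π).mulVecLin) (LinearMap.range (φ.map π).mulVecLin)
    rw [htop, finrank_top, Module.finrank_fin_fun] at h1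
    have h2 := ((Matrix.of ψ).transpose.map π).rank_le_width
    rw [Matrix.rank] at h2 ⊢
    omega
  obtain ⟨f, c, hdet⟩ := Matrix.exists_det_submatrix_ne_zero_of_le_rank _ hrank
  rw [minorsIdeal_le_iff]
  intro h
  refine hdet ?_
  rw [← (hπ _).2 (h f c), RingHom.map_det]
  rfl

theorem minorsIdeal_le_iff_not_exists_locallySpans (hg : Function.Surjective g)
    (hker : LinearMap.ker g = LinearMap.range φ.mulVecLin) (p : Ideal R) [p.IsPrime] (i : ℕ) :
    minorsIdeal φ (n - i) ≤ p ↔ ¬ ∃ v : Fin i → E, LocallySpans p.primeCompl v :=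
  ⟨fun h ⟨_, hv⟩ => not_minorsIdeal_le_of_locallySpans hg hker.le p hv h,
    fun h => not_not.1 (mt (exists_locallySpans_of_not_minorsIdeal_le hg hker.ge p) h)⟩

end Minors

section MinimalGenerators

variable {R M : Type} [CommRing R] [AddCommGroup M] [Module R M] [Module.Finite R M]

theorem minGens_le_iff (i : ℕ) :
    minGens R M ≤ i ↔ ∃ v : Fin i → M, Submodule.span R (Set.range v) = ⊤ := by
  classical
  constructor
  · intro h
    obtain ⟨s, hs, hspan⟩ := Nat.sInf_mem
      (s := {n | ∃ s : Finset M, s.card = n ∧ Submodule.span R (s : Set M) = ⊤})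
      (by
        obtain ⟨s, hs⟩ := Module.Finite.fg_top (R := R) (M := M)
        exact ⟨_, s, rfl, hs⟩)
    obtain ⟨v, hv⟩ := exists_fin_range_of_card_le s (hs.trans_le h)
    exact ⟨v, top_le_iff.1 (hspan.ge.trans (Submodule.span_mono hv))⟩
  · rintro ⟨v, hv⟩
    have hcard : minGens R M ≤ (Finset.univ.image v).card :=
      Nat.sInf_le ⟨_, rfl, by simpa using hv⟩
    exact hcard.trans (Finset.card_image_le.trans_eq (Finset.card_fin i))

theorem minGens_localizedModule_le_iff (S : Submonoid R) (i : ℕ) :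
    minGens (Localization S) (LocalizedModule S M) ≤ i ↔
      ∃ v : Fin i → M, LocallySpans S v := by
  simp only [minGens_le_iff, locallySpans_iff]
  constructor
  · rintro ⟨w, hw⟩
    choose u v hv using fun j => exists_units_smul_eq_mkLinearMap S (w j)
    refine ⟨v, top_le_iff.1 (hw.ge.trans (Submodule.span_le.2 ?_))⟩
    rintro _ ⟨j, rfl⟩
    rw [SetLike.mem_coe, ← inv_smul_smul (u j) (w j), hv, Units.smul_def]
    exact Submodule.smul_mem _ _ (Submodule.subset_span ⟨j, rfl⟩)
  · rintro ⟨v, hv⟩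
    exact ⟨_, hv⟩

end MinimalGenerators

section AssociatedPrimes

variable {R : Type*} [CommRing R] [IsNoetherianRing R]

/-- A vector that survives in the localization at `p` has a multiple whose annihilator is an
associated prime contained in `p`. -/
theorem exists_associatedPrime_eq_annihilator_smul {ι : Type*} [Fintype ι] (p : Ideal R)
    [p.IsPrime] (c : ι → R) (hc : ∀ u ∈ p.primeCompl, ∃ j, u * c j ≠ 0) :
    ∃ q ∈ associatedPrimes R R, q ≤ p ∧
      ∃ r : R, ∀ a, (∀ j, a * (r * c j) = 0) ↔ a ∈ q := by
  classical
  have hle : Module.annihilator R (Submodule.span R {c}) ≤ p := by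
    intro a ha
    by_contra hap
    obtain ⟨j, hj⟩ := hc a hap
    have := Module.mem_annihilator.1 ha ⟨c, Submodule.mem_span_singleton_self c⟩
    exact hj (congrFun (congrArg Subtype.val this) j)
  obtain ⟨q, hq, hqp⟩ := Ideal.exists_minimalPrimes_le hle
  have hq' := Module.associatedPrimes.minimalPrimes_annihilator_subset_associatedPrimes _ _ hq
  obtain ⟨hqprime, ⟨z, hz⟩, hqz⟩ := isAssociatedPrime_iff.1 hq'
  obtain ⟨r, rfl⟩ := Submodule.mem_span_singleton.1 hz
  have hmem : ∀ a, (∀ j, a * (r * c j) = 0) ↔ a ∈ q := by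
    intro a
    rw [hqz, Submodule.mem_colon_singleton, Submodule.mem_bot, ← Subtype.coe_inj, funext_iff]
    rfl
  refine ⟨q, ?_, hqp, r, hmem⟩
  obtain ⟨j, hj⟩ : ∃ j, ∀ a, a * (r * c j) = 0 → a ∈ q := by
    by_contra! hcon
    choose a ha haq using hcon
    have : ∏ j, a j ∈ q := (hmem _).1 fun j => by
      rw [← Finset.prod_erase_mul _ _ (Finset.mem_univ j), mul_assoc, ha, mul_zero]
    obtain ⟨j, -, hj⟩ := hqprime.prod_mem_iff.1 this
    exact haq j hj
  refine isAssociatedPrime_iff.2 ⟨hqprime, r * c j, ?_⟩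
  ext a
  rw [Submodule.mem_colon_singleton, Submodule.mem_bot, smul_eq_mul]
  exact ⟨fun ha => (hmem a).2 ha j, hj a⟩

theorem exists_associatedPrime_le (p : Ideal R) [p.IsPrime] :
    ∃ q ∈ associatedPrimes R R, q ≤ p := by
  obtain ⟨q, hq, hqp⟩ := Ideal.exists_minimalPrimes_le
    (I := Module.annihilator R R) (J := p) (by simp [Module.annihilator_eq_bot.2 inferInstance])
  exact ⟨q, Module.associatedPrimes.minimalPrimes_annihilator_subset_associatedPrimes _ _ hq, hqp⟩

end AssociatedPrimes

section Rank

variable {R E : Type} [CommRing R] [IsNoetherianRing R] [AddCommGroup E] [Module R E]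
  {e : ℕ}

theorem hasRank.locallyIndependent (hrk : hasRank R E e) (p : Ideal R) [p.IsPrime]
    {v : Fin e → E} (hv : LocallySpans p.primeCompl v) : LocallyIndependent p.primeCompl v := by
  intro c hc
  by_contra! hcon
  obtain ⟨q, hq, hqp, r, hr⟩ := exists_associatedPrime_eq_annihilator_smul p c hcon
  have hqprime : q.IsPrime := hq.isPrime
  have hS : p.primeCompl ≤ q.primeCompl := fun u hu hu' => hu (hqp hu')
  have hli := linearIndependent_of_top_le_span_of_card_eq_finrank
    (locallySpans_iff.1 (hv.mono hS)).ge
    ((Fintype.card_fin e).trans (hrk q hqprime hq).2.symm)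
  obtain ⟨u, hu, hu'⟩ := (linearIndependent_mkLinearMap_iff q.primeCompl v).1 hli
    (fun j => r * c j) (by simp only [mul_smul, ← Finset.smul_sum, hc, smul_zero])
  exact hu ((hr u).1 hu')

theorem hasRank.free_of_minGens_le [Module.Finite R E] (hrk : hasRank R E e) (p : Ideal R)
    [p.IsPrime]
    (h : minGens (Localization.AtPrime p) (LocalizedModule p.primeCompl E) ≤ e) :
    Module.Free (Localization.AtPrime p) (LocalizedModule p.primeCompl E) := by
  obtain ⟨v, hv⟩ := (minGens_localizedModule_le_iff _ _).1 h
  obtain ⟨b⟩ := hv.exists_basis (hrk.locallyIndependent p hv)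
  exact .of_basis b

theorem hasRank.minGens_le_of_free [Module.Finite R E] (hrk : hasRank R E e) (p : Ideal R)
    [p.IsPrime] (h : Module.Free (Localization.AtPrime p) (LocalizedModule p.primeCompl E)) :
    minGens (Localization.AtPrime p) (LocalizedModule p.primeCompl E) ≤ e := by
  have : Module.Finite (Localization.AtPrime p) (LocalizedModule p.primeCompl E) :=
    .of_isLocalizedModule p.primeCompl (LocalizedModule.mkLinearMap p.primeCompl E)
  obtain ⟨v, hv, hv'⟩ := exists_locallySpans_of_basis
    (Module.finBasis (Localization.AtPrime p) (LocalizedModule p.primeCompl E))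
  obtain ⟨q, hq, hqp⟩ := exists_associatedPrime_le p
  have hqprime : q.IsPrime := hq.isPrime
  have hS : p.primeCompl ≤ q.primeCompl := fun u hu hu' => hu (hqp hu')
  obtain ⟨b⟩ := (hv.mono hS).exists_basis (hv'.mono hS)
  have hb := Module.finrank_eq_card_basis b
  rw [Fintype.card_fin] at hb
  rw [← (hrk q hqprime hq).2]
  exact (minGens_localizedModule_le_iff _ _).2 (hb ▸ ⟨v, hv⟩)

end Rank

/-- The Fitting-ideal height condition `F_t` holds if and only if locally at every prime
where `E` is not free one has `μ(E_p) ≤ dim R_p + e - t`. -/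
theorem fitting_condition_iff (R E : Type) [CommRing R] [IsNoetherianRing R]
    [AddCommGroup E] [Module R E] [Module.Finite R E]
    (e t : ℕ) (hrk : hasRank R E e)
    (n s : ℕ) (φ : Matrix (Fin n) (Fin s) R) (g : (Fin n → R) →ₗ[R] E)
    (hg : Function.Surjective g)
    (hker : LinearMap.ker g = LinearMap.range φ.mulVecLin) :
    (∀ i : ℕ, e ≤ i → ((i - e + t + 1 : ℕ) : ℕ∞) ≤ idealHeight (minorsIdeal φ (n - i))) ↔
    (∀ (p : Ideal R) (hp : p.IsPrime),
      letI := hp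
      ¬ Module.Free (Localization.AtPrime p) (LocalizedModule p.primeCompl E) →
      ((minGens (Localization.AtPrime p) (LocalizedModule p.primeCompl E) : ℕ) : ℕ∞) + t ≤
        Order.height (⟨p, hp⟩ : PrimeSpectrum R) + e) := by
  constructor
  · intro h p hp hfree
    have hlt : e < minGens (Localization.AtPrime p) (LocalizedModule p.primeCompl E) :=
      lt_of_not_ge fun hle => hfree (hrk.free_of_minGens_le p hle)
    obtain ⟨i, hi⟩ := Nat.exists_eq_add_of_lt hlt
    have hmin : minorsIdeal φ (n - (e + i)) ≤ p := by
      rw [minorsIdeal_le_iff_not_exists_locallySpans hg hker, ← minGens_localizedModule_le_iff]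
      change ¬ minGens (Localization.AtPrime p) (LocalizedModule p.primeCompl E) ≤ _
      omega
    have hht := (h (e + i) (Nat.le_add_right e i)).trans
      (iInf₂_le (⟨p, hp⟩ : PrimeSpectrum R) hmin)
    rw [hi]
    calc ((e + i + 1 : ℕ) : ℕ∞) + t = ((e + i - e + t + 1 : ℕ) : ℕ∞) + e := by
          norm_cast
          omega
      _ ≤ _ := by gcongr
  · intro h i hi
    refine le_iInf₂ fun p hp => ?_
    have hprime := p.isPrime
    rw [minorsIdeal_le_iff_not_exists_locallySpans hg hker, ← minGens_localizedModule_le_iff,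
      not_le] at hp
    have hle := h p.asIdeal p.isPrime fun hfree =>
      (hp.trans_le (hrk.minGens_le_of_free p.asIdeal hfree)).not_ge hi
    refine (ENat.add_le_add_iff_right (ENat.natCast_ne_top e)).1 (le_trans ?_ hle)
    norm_cast
    have hp' : i < minGens (Localization.AtPrime p.asIdeal)
      (LocalizedModule p.asIdeal.primeCompl E) := hp
    omega
end
end

section
/- Let R be a local Cohen-Macaulay ring and E a finite R-module with rank e and projective dimension at most 1. Then E satisfies condition F_0 (i.e., ht F_i(E) ≥ i − e + 1 for all i ≥ e) if and only if the symmetric algebra S(E) is a complete intersection ring. -/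
noncomputable section

/-- A Noetherian local ring is Cohen-Macaulay if its maximal ideal contains a regular
sequence whose length equals its Krull dimension. -/
def IsCohenMacaulayLocalRing (A : Type) [CommRing A] [IsLocalRing A] : Prop :=
  ∃ rs : List A, (∀ r ∈ rs, r ∈ IsLocalRing.maximalIdeal A) ∧
    RingTheory.Sequence.IsRegular A rs ∧ (rs.length : WithBot ℕ∞) = ringKrullDim A

/-- A ring is Cohen-Macaulay if all its localizations at primes are Cohen-Macaulay
local rings. -/
def IsCohenMacaulayRing (A : Type) [CommRing A] : Prop :=
  ∀ (p : Ideal A) (hp : p.IsPrime),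
    letI := hp
    IsCohenMacaulayLocalRing (Localization.AtPrime p)

/-- The defining relations of the symmetric algebra of a module, inside the polynomial
ring on the underlying set of the module. -/
def symRels (R M : Type) [CommRing R] [AddCommGroup M] [Module R M] :
    Set (MvPolynomial M R) :=
  {p | ∃ x y : M, p = MvPolynomial.X (x + y) - MvPolynomial.X x - MvPolynomial.X y} ∪
    {p | ∃ (r : R) (x : M), p = MvPolynomial.X (r • x) - MvPolynomial.C r * MvPolynomial.X x}

/-- The symmetric algebra of an `R`-module `M`. -/
abbrev SymmAlgebra (R M : Type) [CommRing R] [AddCommGroup M] [Module R M] : Type :=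
  MvPolynomial M R ⧸ Ideal.span (symRels R M)

/-! ### Regular elements modulo an ideal and grade -/

/-- The element `x` is a nonzerodivisor modulo the ideal `J`. -/
def IsRegularMod {A : Type*} [CommRing A] (J : Ideal A) (x : A) : Prop :=
  ∀ a, x * a ∈ J → a ∈ J

/-- The ideal `I` contains a sequence of length `n` that is weakly regular on `A ⧸ J`. -/
def HasGrade {A : Type*} [CommRing A] (I : Ideal A) : Ideal A → ℕ → Prop
  | _, 0 => True
  | J, n + 1 => ∃ x ∈ I, IsRegularMod J x ∧ HasGrade I (J ⊔ Ideal.span {x}) n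

section Grade

variable {A : Type*} [CommRing A]

theorem mem_sup_span_singleton_iff {J : Ideal A} {x a : A} :
    a ∈ J ⊔ Ideal.span {x} ↔ ∃ c, a - x * c ∈ J := by
  rw [Submodule.mem_sup]
  constructor
  · rintro ⟨j, hj, y, hy, rfl⟩
    obtain ⟨c, rfl⟩ := Ideal.mem_span_singleton'.1 hy
    exact ⟨c, by convert hj using 1; ring⟩
  · rintro ⟨c, hc⟩
    exact ⟨_, hc, x * c, Ideal.mem_span_singleton'.2 ⟨c, mul_comm _ _⟩, by ring⟩

theorem exists_mem_iff_of_mem_associatedPrimes [IsNoetherianRing A] {J P : Ideal A}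
    (hP : P ∈ associatedPrimes A (A ⧸ J)) : ∃ b, ∀ a, a ∈ P ↔ a * b ∈ J := by
  obtain ⟨-, x, hx⟩ := isAssociatedPrime_iff.1 hP
  obtain ⟨b, rfl⟩ := Ideal.Quotient.mk_surjective x
  refine ⟨b, fun a => ?_⟩
  rw [hx, Submodule.mem_colon_singleton, Submodule.mem_bot, ← Ideal.Quotient.eq_zero_iff_mem,
    map_mul, Algebra.smul_def]
  rfl

theorem exists_associatedPrime_of_notMem [IsNoetherianRing A] {J : Ideal A} {b : A} (hb : b ∉ J) :
    ∃ P ∈ associatedPrimes A (A ⧸ J), ∀ a, a * b ∈ J → a ∈ P := by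
  obtain ⟨P, hP, h⟩ := exists_le_isAssociatedPrime_of_isNoetherianRing A
    (Ideal.Quotient.mk J b) (by rwa [Ne, Ideal.Quotient.eq_zero_iff_mem])
  refine ⟨P, hP, fun a ha => h ?_⟩
  rw [Submodule.mem_colon_singleton, Submodule.mem_bot, Algebra.smul_def]
  exact (map_mul (Ideal.Quotient.mk J) a b).symm.trans (Ideal.Quotient.eq_zero_iff_mem.2 ha)

theorem isRegularMod_iff [IsNoetherianRing A] {J : Ideal A} {x : A} :
    IsRegularMod J x ↔ ∀ P ∈ associatedPrimes A (A ⧸ J), x ∉ P := by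
  constructor
  · intro h P hP hx
    obtain ⟨b, hb⟩ := exists_mem_iff_of_mem_associatedPrimes hP
    have h1 : b ∈ J := h b ((hb x).1 hx)
    exact (IsAssociatedPrime.isPrime hP).ne_top
      ((Ideal.eq_top_iff_one P).2 ((hb 1).2 (by simpa using h1)))
  · intro h a ha
    by_contra hb
    obtain ⟨P, hP, hPa⟩ := exists_associatedPrime_of_notMem hb
    exact h P hP (hPa x ha)

theorem exists_isRegularMod_of_forall [IsNoetherianRing A] {I : Ideal A} {S : Set (Ideal A)}
    (hS : S.Finite) (h : ∀ J ∈ S, ∃ x ∈ I, IsRegularMod J x) :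
    ∃ x ∈ I, ∀ J ∈ S, IsRegularMod J x := by
  by_contra! hcon
  have hfin : (⋃ J ∈ S, associatedPrimes A (A ⧸ J)).Finite :=
    hS.biUnion fun J _ => associatedPrimes.finite A (A ⧸ J)
  obtain ⟨P, hP, hIP⟩ := (I.subset_union_prime_finite hfin (f := id) 0 0 fun P hP _ _ => by
    obtain ⟨J, _, hP⟩ := Set.mem_iUnion₂.1 hP
    exact IsAssociatedPrime.isPrime hP).1 <| by
      intro x hx
      obtain ⟨J, hJ, hJx⟩ := hcon x hx
      rw [isRegularMod_iff] at hJx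
      push Not at hJx
      obtain ⟨P, hP, hxP⟩ := hJx
      exact Set.mem_iUnion₂.2 ⟨P, Set.mem_iUnion₂.2 ⟨J, hJ, hP⟩, hxP⟩
  obtain ⟨J, hJ, hP⟩ := Set.mem_iUnion₂.1 hP
  obtain ⟨x, hxI, hx⟩ := h J hJ
  exact isRegularMod_iff.1 hx P hP (hIP hxI)

theorem exists_le_associatedPrime_of_forall_not_isRegularMod [IsNoetherianRing A] {I J : Ideal A}
    (h : ∀ x ∈ I, ¬ IsRegularMod J x) : ∃ P ∈ associatedPrimes A (A ⧸ J), I ≤ P := by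
  by_contra! hcon
  refine absurd ((I.subset_union_prime_finite (associatedPrimes.finite A (A ⧸ J)) (f := id) 0 0
    fun P hP _ _ => IsAssociatedPrime.isPrime hP).1 ?_) (by simpa using hcon)
  intro x hx
  have := h x hx
  rw [isRegularMod_iff] at this
  push Not at this
  obtain ⟨P, hP, hxP⟩ := this
  exact Set.mem_iUnion₂.2 ⟨P, hP, hxP⟩

/-- If `I` contains a regular element modulo `J + (z)`, the same holds modulo `J + (x)`
for every `x ∈ I` regular modulo `J`. -/
theorem exists_isRegularMod_sup_span_singleton [IsNoetherianRing A] {I J : Ideal A} {x z : A}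
    (hx : IsRegularMod J x) (hzI : z ∈ I) (hz : IsRegularMod J z)
    (h : ∃ w ∈ I, IsRegularMod (J ⊔ Ideal.span {z}) w) :
    ∃ w ∈ I, IsRegularMod (J ⊔ Ideal.span {x}) w := by
  by_contra! hcon
  obtain ⟨P, hP, hIP⟩ := exists_le_associatedPrime_of_forall_not_isRegularMod hcon
  obtain ⟨w, hwI, hw⟩ := h
  obtain ⟨b, hb⟩ := exists_mem_iff_of_mem_associatedPrimes hP
  have hbn : b ∉ J ⊔ Ideal.span {x} := fun hmem => (IsAssociatedPrime.isPrime hP).ne_top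
    ((Ideal.eq_top_iff_one P).2 ((hb 1).2 (by simpa using hmem)))
  have hmul : ∀ a ∈ I, a * b ∈ J ⊔ Ideal.span {x} := fun a ha => (hb a).1 (hIP ha)
  obtain ⟨c, hc⟩ := mem_sup_span_singleton_iff.1 (hmul z hzI)
  obtain ⟨d, hd⟩ := mem_sup_span_singleton_iff.1 (hmul w hwI)
  have hwc : w * c ∈ J ⊔ Ideal.span {z} := by
    refine mem_sup_span_singleton_iff.2 ⟨d, hx _ ?_⟩
    have : x * (w * c - z * d) = z * (w * b - x * d) - w * (z * b - x * c) := by ring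
    rw [this]
    exact J.sub_mem (J.mul_mem_left _ hd) (J.mul_mem_left _ hc)
  obtain ⟨u, hu⟩ := mem_sup_span_singleton_iff.1 (hw c hwc)
  refine hbn (mem_sup_span_singleton_iff.2 ⟨u, hz _ ?_⟩)
  have : z * (b - x * u) = (z * b - x * c) + x * (c - z * u) := by ring
  rw [this]
  exact J.add_mem hc (J.mul_mem_left _ hu)

theorem IsRegularMod.swap {J : Ideal A} {y z : A} (hz : IsRegularMod J z)
    (hyz : IsRegularMod (J ⊔ Ideal.span {z}) y) : IsRegularMod (J ⊔ Ideal.span {y}) z := by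
  intro m hm
  obtain ⟨c, hc⟩ := mem_sup_span_singleton_iff.1 hm
  have h1 : c ∈ J ⊔ Ideal.span {z} := by
    refine hyz _ (mem_sup_span_singleton_iff.2 ⟨m, ?_⟩)
    rw [← neg_mem_iff]
    convert hc using 1
    ring
  obtain ⟨d, hd⟩ := mem_sup_span_singleton_iff.1 h1
  refine mem_sup_span_singleton_iff.2 ⟨d, hz _ ?_⟩
  have : z * (m - y * d) = (z * m - y * c) + y * (c - z * d) := by ring
  rw [this]
  exact J.add_mem hc (J.mul_mem_left _ hd)

/-- Dividing out a regular element lowers the grade by at most one. -/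
theorem HasGrade.sup_span_singleton [IsNoetherianRing A] {I : Ideal A} {n : ℕ} {J : Ideal A}
    {x : A} (h : HasGrade I J (n + 1)) (hxI : x ∈ I) (hx : IsRegularMod J x) :
    HasGrade I (J ⊔ Ideal.span {x}) n := by
  induction n generalizing J x with
  | zero => trivial
  | succ n ih =>
    obtain ⟨z, hzI, hz, hzn⟩ := h
    have hwz : ∃ w ∈ I, IsRegularMod (J ⊔ Ideal.span {z}) w := by
      obtain ⟨w, hwI, hw, -⟩ := hzn
      exact ⟨w, hwI, hw⟩
    have hwx := exists_isRegularMod_sup_span_singleton hx hzI hz hwz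
    obtain ⟨y, hyI, hy⟩ := exists_isRegularMod_of_forall (I := I)
      (S := {J, J ⊔ Ideal.span {x}, J ⊔ Ideal.span {z}}) (by simp) (by
        simp only [Set.mem_insert_iff, Set.mem_singleton_iff, forall_eq_or_imp, forall_eq]
        exact ⟨⟨x, hxI, hx⟩, hwx, hwz⟩)
    have hyx := hy (J ⊔ Ideal.span {x}) (by simp)
    have hyz := hy (J ⊔ Ideal.span {z}) (by simp)
    have h1 : HasGrade I (J ⊔ Ideal.span {y}) (n + 1) := by
      refine ⟨z, hzI, hz.swap hyz, ?_⟩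
      rw [sup_right_comm]
      exact ih hzn hyI hyz
    refine ⟨y, hyI, hyx, ?_⟩
    rw [sup_right_comm]
    exact ih h1 hxI (hx.swap hyx)

theorem HasGrade.mono_right {I : Ideal A} {n m : ℕ} {J : Ideal A} (h : HasGrade I J n)
    (hmn : m ≤ n) : HasGrade I J m := by
  induction m generalizing n J with
  | zero => trivial
  | succ m ih =>
    obtain ⟨n, rfl⟩ : ∃ k, n = k + 1 := ⟨n - 1, by omega⟩
    obtain ⟨x, hx, hxr, h⟩ := h
    exact ⟨x, hx, hxr, ih h (by omega)⟩

theorem not_hasGrade_of_mem_associatedPrimes [IsNoetherianRing A] {J P : Ideal A}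
    (hP : P ∈ associatedPrimes A (A ⧸ J)) {n : ℕ} (hn : n ≠ 0) : ¬ HasGrade P J n := by
  obtain ⟨n, rfl⟩ := Nat.exists_eq_succ_of_ne_zero hn
  rintro ⟨x, hx, hxr, -⟩
  exact isRegularMod_iff.1 hxr P hP hx

/-- An associated prime `P` of `A ⧸ J` is contained in an associated prime of `A ⧸ (J + (x))`
that contains `x`, for `x` in the Jacobson radical. -/
theorem exists_associatedPrime_sup_span_singleton [IsNoetherianRing A] {J P : Ideal A} {x : A}
    (hxm : x ∈ Ideal.jacobson (⊥ : Ideal A)) (hx : IsRegularMod J x)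
    (hP : P ∈ associatedPrimes A (A ⧸ J)) :
    ∃ P' ∈ associatedPrimes A (A ⧸ (J ⊔ Ideal.span {x})), P < P' := by
  obtain ⟨b, hb⟩ := exists_mem_iff_of_mem_associatedPrimes hP
  have hbJ : b ∉ J := fun hmem => (IsAssociatedPrime.isPrime hP).ne_top
    ((Ideal.eq_top_iff_one P).2 ((hb 1).2 (by simpa using hmem)))
  obtain ⟨u, huP, hu⟩ : ∃ u, (∀ a ∈ P, a * u ∈ J) ∧ u ∉ J ⊔ Ideal.span {x} := by
    by_contra! hcon
    let N : Ideal A :=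
      { carrier := {u | ∀ a ∈ P, a * u ∈ J}
        add_mem' := fun {u v} hu hv a ha => by
          rw [mul_add]; exact J.add_mem (hu a ha) (hv a ha)
        zero_mem' := fun a _ => by simp
        smul_mem' := fun c u hu a ha => by
          rw [smul_eq_mul, mul_left_comm]; exact J.mul_mem_left _ (hu a ha) }
    have hN : N ≤ J ⊔ Ideal.span {x} • N := by
      intro u hu
      obtain ⟨c, hc⟩ := mem_sup_span_singleton_iff.1 (hcon u hu)
      have hcN : c ∈ N := fun a ha => hx _ (by
        have : x * (a * c) = a * u - a * (u - x * c) := by ring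
        rw [this]
        exact J.sub_mem (hu a ha) (J.mul_mem_left _ hc))
      have : u = (u - x * c) + x • c := by rw [smul_eq_mul]; ring
      rw [this]
      exact Submodule.add_mem_sup hc
        (Submodule.smul_mem_smul (Ideal.mem_span_singleton_self x) hcN)
    have hle := Submodule.le_of_le_smul_of_le_jacobson_bot (I := Ideal.span {x})
      (IsNoetherian.noetherian N) (by rwa [Ideal.span_le, Set.singleton_subset_iff]) hN
    exact hbJ (hle fun a ha => (hb a).1 ha)
  obtain ⟨P', hP', h⟩ := exists_associatedPrime_of_notMem hu
  refine ⟨P', hP', lt_of_le_of_ne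
    (fun a ha => h a (Ideal.mem_sup_left (huP a ha))) fun heq => ?_⟩
  have hxP' : x ∈ P' := h x (Ideal.mem_sup_right
    (Ideal.mul_mem_right _ _ (Ideal.mem_span_singleton_self x)))
  exact isRegularMod_iff.1 hx P hP (heq ▸ hxP')

/-- The grade of the maximal ideal modulo `J` is at most the dimension of each associated prime
of `A ⧸ J`. -/
theorem HasGrade.le_coheight [IsNoetherianRing A] [IsLocalRing A] {J : Ideal A} {n : ℕ}
    (h : HasGrade (IsLocalRing.maximalIdeal A) J n) (P : PrimeSpectrum A)
    (hP : P.asIdeal ∈ associatedPrimes A (A ⧸ J)) : (n : ℕ∞) ≤ Order.coheight P := by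
  induction n generalizing J P with
  | zero => simp
  | succ n ih =>
    obtain ⟨x, hxm, hx, h⟩ := h
    obtain ⟨P', hP', hlt⟩ := exists_associatedPrime_sup_span_singleton
      (by rwa [IsLocalRing.jacobson_eq_maximalIdeal _ bot_ne_top]) hx hP
    have := ih h ⟨P', IsAssociatedPrime.isPrime hP'⟩ hP'
    push_cast
    exact (add_le_add_left this 1).trans
      (Order.coheight_add_one_le (show P < ⟨P', IsAssociatedPrime.isPrime hP'⟩ from hlt))

/-- Lower bound for the grade of a prime in a local ring, in terms of the grade of the
maximal ideal. -/
theorem HasGrade.of_maximalIdeal [IsNoetherianRing A] [IsLocalRing A] {k c : ℕ} {J : Ideal A}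
    (h : HasGrade (IsLocalRing.maximalIdeal A) J (k + c)) (p : PrimeSpectrum A)
    (hp : Order.coheight p ≤ c) : HasGrade p.asIdeal J k := by
  induction k generalizing J with
  | zero => trivial
  | succ k ih =>
    obtain ⟨x, hxp, hx⟩ : ∃ x ∈ p.asIdeal, IsRegularMod J x := by
      by_contra! hcon
      obtain ⟨P, hP, hle⟩ := exists_le_associatedPrime_of_forall_not_isRegularMod hcon
      have h1 := h.le_coheight ⟨P, IsAssociatedPrime.isPrime hP⟩ hP
      have h2 : Order.coheight (⟨P, IsAssociatedPrime.isPrime hP⟩ : PrimeSpectrum A) ≤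
        Order.coheight p := Order.coheight_anti hle
      have := h1.trans (h2.trans hp)
      norm_cast at this
      omega
    refine ⟨x, hxp, hx, ih ?_⟩
    rw [show k + 1 + c = (k + c) + 1 by omega] at h
    exact h.sup_span_singleton (IsLocalRing.le_maximalIdeal p.isPrime.ne_top hxp) hx

end Grade

open Polynomial in
attribute [local instance] Polynomial.algebra Polynomial.isLocalization in
theorem Polynomial.height_le_height_comap_add_one {R : Type*} [CommRing R] [IsNoetherianRing R]
    (Q : Ideal R[X]) [Q.IsPrime] : Q.height ≤ (Q.comap C).height + 1 := by
  set p := Q.comap C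
  have disj : Disjoint (p.primeCompl.map C : Set R[X]) Q := by
    refine Set.disjoint_left.mpr ?_
    rintro a ⟨b, hb, rfl⟩ ha
    exact hb ha
  let Rₚ := Localization.AtPrime p
  have hne : (Q.map (algebraMap R[X] Rₚ[X])).IsPrime :=
    IsLocalization.isPrime_of_isPrime_disjoint (p.primeCompl.map C) _ _ inferInstance disj
  have h1 := IsLocalization.height_map_of_disjoint (S := Rₚ[X])
    (Submonoid.map C p.primeCompl) Q disj
  have h2 := Ideal.height_le_ringKrullDim_of_ne_top hne.ne_top
  rw [Polynomial.ringKrullDim_of_isNoetherianRing, h1,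
    IsLocalization.AtPrime.ringKrullDim_eq_height p] at h2
  exact_mod_cast h2

attribute [local instance] MvPolynomial.algebraMvPolynomial in
theorem MvPolynomial.height_le_height_comap_add {R : Type*} [CommRing R] [IsNoetherianRing R]
    {σ : Type*} [Finite σ] (Q : Ideal (MvPolynomial σ R)) [Q.IsPrime] :
    Q.height ≤ (Q.comap MvPolynomial.C).height + Nat.card σ := by
  set p := Q.comap MvPolynomial.C
  have disj : Disjoint ((p.primeCompl.map (MvPolynomial.C (σ := σ)) : Submonoid _) :
      Set (MvPolynomial σ R)) Q := by
    refine Set.disjoint_left.mpr ?_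
    rintro a ⟨b, hb, rfl⟩ ha
    exact hb ha
  let Rₚ := Localization.AtPrime p
  have hne : (Q.map (algebraMap (MvPolynomial σ R) (MvPolynomial σ Rₚ))).IsPrime :=
    IsLocalization.isPrime_of_isPrime_disjoint (p.primeCompl.map MvPolynomial.C) _ _
      inferInstance disj
  have h1 := IsLocalization.height_map_of_disjoint (S := MvPolynomial σ Rₚ)
    (p.primeCompl.map MvPolynomial.C) Q disj
  have h2 := Ideal.height_le_ringKrullDim_of_ne_top hne.ne_top
  rw [MvPolynomial.ringKrullDim_of_isNoetherianRing, h1,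
    IsLocalization.AtPrime.ringKrullDim_eq_height p] at h2
  exact_mod_cast h2

/-- `rs` is a weakly regular sequence on `A ⧸ J`. -/
def RegSeqMod {A : Type*} [CommRing A] : Ideal A → List A → Prop
  | _, [] => True
  | J, x :: rs => IsRegularMod J x ∧ RegSeqMod (J ⊔ Ideal.span {x}) rs

section

variable {A : Type*} [CommRing A]

theorem sup_ofList_cons (J : Ideal A) (x : A) (rs : List A) :
    J ⊔ Ideal.ofList (x :: rs) = (J ⊔ Ideal.span {x}) ⊔ Ideal.ofList rs := by
  rw [Ideal.ofList_cons, sup_assoc]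

theorem regSeqMod_iff {J : Ideal A} {rs : List A} : RegSeqMod J rs ↔
    ∀ i (h : i < rs.length), IsRegularMod (J ⊔ Ideal.ofList (rs.take i)) rs[i] := by
  induction rs generalizing J with
  | nil => simp [RegSeqMod]
  | cons x rs ih =>
    rw [RegSeqMod, ih]
    constructor
    · rintro ⟨h0, h⟩ (_ | i) hi
      · simpa using h0
      · simpa [sup_assoc] using h i (by simpa using hi)
    · intro h
      refine ⟨?_, fun i hi => ?_⟩
      · have := h 0 (by simp)
        rwa [List.take_zero, Ideal.ofList_nil, sup_bot_eq] at this
      · have := h (i + 1) (by simpa using hi)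
        rwa [List.take_succ_cons, sup_ofList_cons] at this

theorem regSeqMod_bot_iff {rs : List A} :
    RegSeqMod ⊥ rs ↔ RingTheory.Sequence.IsWeaklyRegular A rs := by
  rw [regSeqMod_iff]
  constructor
  · intro h
    refine ⟨fun i hi => ?_⟩
    rw [isSMulRegular_quotient_iff_mem_of_smul_mem]
    intro a ha
    simpa using h i hi a (by simpa using ha)
  · intro h i hi a ha
    have := (isSMulRegular_quotient_iff_mem_of_smul_mem _ _).1 (h.regular_mod_prev i hi) a
      (by simpa using ha)
    simpa using this

theorem hasGrade_iff {I J : Ideal A} {n : ℕ} :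
    HasGrade I J n ↔ ∃ rs : List A, rs.length = n ∧ (∀ r ∈ rs, r ∈ I) ∧ RegSeqMod J rs := by
  induction n generalizing J with
  | zero => exact ⟨fun _ => ⟨[], by simp [RegSeqMod]⟩, fun _ => trivial⟩
  | succ n ih =>
    constructor
    · rintro ⟨x, hx, hxr, h⟩
      obtain ⟨rs, hl, hI, hr⟩ := ih.1 h
      exact ⟨x :: rs, by simpa using hl, by simpa using ⟨hx, hI⟩, hxr, hr⟩
    · rintro ⟨rs, hl, hI, hr⟩
      obtain _ | ⟨x, rs⟩ := rs
      · simp at hl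
      · exact ⟨x, hI x (by simp), hr.1,
          ih.2 ⟨rs, by simpa using hl, fun r hrs => hI r (by simp [hrs]), hr.2⟩⟩

theorem RegSeqMod.hasGrade_sup [IsNoetherianRing A] {I J : Ideal A} {rs : List A} {k : ℕ}
    (hr : RegSeqMod J rs) (hI : ∀ r ∈ rs, r ∈ I) (h : HasGrade I J (rs.length + k)) :
    HasGrade I (J ⊔ Ideal.ofList rs) k := by
  induction rs generalizing J with
  | nil => simpa using h
  | cons x rs ih =>
    rw [sup_ofList_cons]
    refine ih hr.2 (fun r hrs => hI r (by simp [hrs])) ?_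
    refine HasGrade.sup_span_singleton ?_ (hI x (by simp)) hr.1
    simpa [add_right_comm] using h

theorem RegSeqMod.hasGrade_of_sup {I J : Ideal A} {rs : List A} {k : ℕ}
    (hr : RegSeqMod J rs) (hI : ∀ r ∈ rs, r ∈ I) (h : HasGrade I (J ⊔ Ideal.ofList rs) k) :
    HasGrade I J (rs.length + k) := by
  induction rs generalizing J with
  | nil => simpa using h
  | cons x rs ih =>
    rw [sup_ofList_cons] at h
    rw [List.length_cons, add_right_comm]
    exact ⟨x, hI x (by simp), hr.1, ih hr.2 (fun r hrs => hI r (by simp [hrs])) h⟩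

theorem RegSeqMod.map_C {J : Ideal A} {rs : List A} (h : RegSeqMod J rs) :
    RegSeqMod (J.map Polynomial.C) (rs.map Polynomial.C) := by
  induction rs generalizing J with
  | nil => trivial
  | cons x rs ih =>
    refine ⟨fun a ha => ?_, ?_⟩
    · rw [Ideal.mem_map_C_iff] at ha ⊢
      intro n
      exact h.1 _ (by simpa using ha n)
    · have := ih h.2
      rwa [Ideal.map_sup, Ideal.map_span, Set.image_singleton] at this

end

/-- The grade of every prime ideal is at least its height. -/
def HeightLEGrade (A : Type*) [CommRing A] : Prop :=
  ∀ (p : Ideal A) [p.IsPrime] (n : ℕ), (n : ℕ∞) ≤ p.height → HasGrade p ⊥ n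

theorem HeightLEGrade.of_isCohenMacaulay {R : Type} [CommRing R] [IsLocalRing R]
    [IsNoetherianRing R] (h : IsCohenMacaulayLocalRing R) : HeightLEGrade R := by
  obtain ⟨rs, hm, hr, hd⟩ := h
  intro p hp n hn
  have hg : HasGrade (IsLocalRing.maximalIdeal R) ⊥ rs.length :=
    hasGrade_iff.2 ⟨rs, rfl, hm, regSeqMod_bot_iff.2 hr.toIsWeaklyRegular⟩
  let P : PrimeSpectrum R := ⟨p, hp⟩
  have h1 : ((Order.height P + Order.coheight P : ℕ∞) : WithBot ℕ∞) ≤ rs.length := by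
    rw [hd, ringKrullDim, Order.krullDim_eq_iSup_height_add_coheight_of_nonempty]
    exact_mod_cast le_iSup (fun a : PrimeSpectrum R => Order.height a + Order.coheight a) P
  have h1' : Order.height P + Order.coheight P ≤ (rs.length : ℕ∞) := by exact_mod_cast h1
  have hhp : p.height = Order.height P := by
    exact P.height_eq_orderHeight
  obtain ⟨c, hc⟩ : ∃ c : ℕ, Order.coheight P = c := by
    refine ENat.ne_top_iff_exists.1 ?_ |>.imp fun _ => Eq.symm
    exact ne_top_of_le_ne_top (ENat.natCast_ne_top _) (le_add_self.trans h1')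
  refine HasGrade.of_maximalIdeal (c := c) (hg.mono_right ?_) P hc.le
  rw [hc, ← hhp] at h1'
  exact_mod_cast (add_le_add_left hn (c : ℕ∞)).trans h1'

theorem HeightLEGrade.of_ringEquiv {A B : Type*} [CommRing A] [CommRing B] (f : A ≃+* B)
    (h : HeightLEGrade A) : HeightLEGrade B := by
  have key : ∀ (I J : Ideal B) (n : ℕ), HasGrade (I.comap (f : A →+* B)) (J.comap (f : A →+* B)) n →
      HasGrade I J n := by
    intro I J n hn
    induction n generalizing J with
    | zero => trivial
    | succ n ih =>
      obtain ⟨x, hx, hxr, hh⟩ := hn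
      refine ⟨f x, hx, fun b hb => ?_, ih _ ?_⟩
      · obtain ⟨a, rfl⟩ := f.surjective b
        exact hxr a (by simpa using hb)
      · convert hh using 1
        ext a
        rw [mem_sup_span_singleton_iff, Ideal.mem_comap, mem_sup_span_singleton_iff]
        constructor
        · rintro ⟨c, hc⟩
          exact ⟨f.symm c, by simpa using hc⟩
        · rintro ⟨c, hc⟩
          exact ⟨f c, by simpa using hc⟩
  intro p hp n hn
  refine key p ⊥ n ?_
  have hb : (⊥ : Ideal B).comap (f : A →+* B) = ⊥ := by
    ext a; simp
  rw [hb]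
  refine h _ n ?_
  rw [show (p.comap (f : A →+* B)).height = p.height from RingEquiv.height_comap f p]
  exact hn

open Polynomial in
theorem HeightLEGrade.polynomial {R : Type*} [CommRing R] [IsNoetherianRing R]
    (hR : HeightLEGrade R) : HeightLEGrade R[X] := by
  intro Q hQ n hn
  set p := Q.comap C with hp
  have : Q.LiesOver p := ⟨rfl⟩
  obtain ⟨h, hh⟩ : ∃ h : ℕ, p.height = h := by
    refine ENat.ne_top_iff_exists.1 ?_ |>.imp fun _ => Eq.symm
    exact Ideal.height_ne_top_of_isPrime
  obtain ⟨rs, hl, hI, hr⟩ := hasGrade_iff.1 (hR p h hh.ge)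
  have hr' : RegSeqMod ⊥ (rs.map (C : R →+* R[X])) := by simpa using hr.map_C
  have hI' : ∀ r ∈ rs.map (C : R →+* R[X]), r ∈ Q := by
    simpa [p] using hI
  by_cases hQp : Q = p.map C
  · have h0 : Q.height = p.height := by
      have := Ideal.height_eq_height_add_of_liesOver_of_hasGoingDown p Q
      rw [this, hQp]
      simp
    rw [h0, hh] at hn
    refine HasGrade.mono_right ?_ (m := n) (n := h) (by exact_mod_cast hn)
    exact hasGrade_iff.2 ⟨_, by simpa using hl, hI', hr'⟩
  refine HasGrade.mono_right (n := h + 1) ?_ ?_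
  swap
  · have := hn.trans (Polynomial.height_le_height_comap_add_one Q)
    rw [← hp, hh] at this
    exact_mod_cast this
  rw [show h = (rs.map (C : R →+* R[X])).length by simpa using hl.symm]
  refine hr'.hasGrade_of_sup hI' ?_
  by_contra hcon
  have hJ : (⊥ ⊔ Ideal.ofList (rs.map (C : R →+* R[X]))) = (Ideal.ofList rs).map C := by
    simp [Ideal.map_ofList]
  rw [hJ] at hcon
  set J := Ideal.ofList rs
  have hle : ∀ f ∈ Q, ∃ p' ∈ associatedPrimes R (R ⧸ J), f ∈ p'.map C := by
    intro f hf
    have : ¬ IsRegularMod (J.map C) f := fun hreg => hcon ⟨f, hf, hreg, trivial⟩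
    rw [IsRegularMod] at this
    push Not at this
    obtain ⟨b, hb, hbJ⟩ := this
    have hz : f.map (Ideal.Quotient.mk J) ∉ nonZeroDivisors (R ⧸ J)[X] := by
      intro hmem
      apply hbJ
      rw [← Ideal.mk_ker (I := J), ← Polynomial.ker_mapRingHom, RingHom.mem_ker] at hb ⊢
      rw [map_mul] at hb
      exact (mul_right_mem_nonZeroDivisors_eq_zero_iff hmem).1 ((mul_comm _ _).trans hb)
    rw [Polynomial.notMem_nonZeroDivisors_iff] at hz
    obtain ⟨a, ha, haf⟩ := hz
    obtain ⟨a, rfl⟩ := Ideal.Quotient.mk_surjective a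
    rw [Ne, Ideal.Quotient.eq_zero_iff_mem] at ha
    obtain ⟨P, hP, hPa⟩ := exists_associatedPrime_of_notMem ha
    refine ⟨P, hP, Ideal.mem_map_C_iff.2 fun i => hPa _ ?_⟩
    have := congrArg (fun q => q.coeff i) haf
    simp only [coeff_smul, coeff_map, smul_eq_mul, coeff_zero] at this
    rw [← map_mul, Ideal.Quotient.eq_zero_iff_mem] at this
    rwa [mul_comm]
  obtain ⟨p', hp', hQp'⟩ : ∃ p' ∈ associatedPrimes R (R ⧸ J), Q ≤ p'.map C := by
    have := (Q.subset_union_prime_finite (associatedPrimes.finite R (R ⧸ J))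
      (f := fun p' => p'.map C) 0 0 fun P hP _ _ => by
        have := IsAssociatedPrime.isPrime hP
        exact Ideal.isPrime_map_C_of_isPrime).1 (by
          intro f hf
          simpa using hle f hf)
    simpa using this
  have hp'prime := IsAssociatedPrime.isPrime hp'
  have hpp' : p ≤ p' := by
    intro x hx
    have := Ideal.mem_map_C_iff.1 (hQp' hx) 0
    simpa using this
  have hht : ¬ ((h + 1 : ℕ) : ℕ∞) ≤ p'.height := by
    intro hge
    have h1 := hR p' (h + 1) hge
    rw [← hl] at h1
    have h2 := hr.hasGrade_sup (fun r hr => hpp' (hI r hr)) h1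
    rw [bot_sup_eq] at h2
    exact not_hasGrade_of_mem_associatedPrimes hp' one_ne_zero h2
  have heq : p = p' := by
    by_contra hne
    apply hht
    have := Ideal.height_add_one_le_of_lt_of_isPrime (lt_of_le_of_ne hpp' hne)
    rw [hh] at this
    exact_mod_cast this
  apply hQp
  refine le_antisymm (heq ▸ hQp') (Ideal.map_le_iff_le_comap.2 le_rfl)

theorem HeightLEGrade.mvPolynomial {R : Type*} [CommRing R] [IsNoetherianRing R]
    (hR : HeightLEGrade R) (n : ℕ) : HeightLEGrade (MvPolynomial (Fin n) R) := by
  induction n with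
  | zero => exact hR.of_ringEquiv (MvPolynomial.isEmptyRingEquiv R (Fin 0)).symm
  | succ n ih => exact ih.polynomial.of_ringEquiv (MvPolynomial.finSuccEquiv R n).toRingEquiv.symm

section LinearPrimes

open MvPolynomial

variable {R : Type*} [CommRing R] {n : ℕ}

/-- The linear form with a given coefficient vector. -/
def linForm (R : Type*) [CommRing R] (n : ℕ) : (Fin n → R) →ₗ[R] MvPolynomial (Fin n) R :=
  Fintype.linearCombination R X

theorem linForm_apply (v : Fin n → R) : linForm R n v = ∑ i, v i • X i := rfl

theorem linForm_single (i : Fin n) : linForm R n (Pi.single i 1) = X i := by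
  simp [linForm, Fintype.linearCombination_apply_single]

theorem linForm_injective : Function.Injective (linForm R n) := by
  refine (injective_iff_map_eq_zero _).2 fun v hv => ?_
  ext j
  have := congrArg (coeff (Finsupp.single j 1)) hv
  simpa [linForm_apply, coeff_sum, coeff_smul, coeff_X, Finsupp.single_left_inj] using this

theorem map_linForm {S : Type*} [CommRing S] (f : R →+* S) (v : Fin n → R) :
    MvPolynomial.map f (linForm R n v) = linForm S n (f ∘ v) := by
  simp [linForm_apply, MvPolynomial.smul_eq_C_mul]

section Field

variable {k : Type*} [Field k]

/-- The substitution of variables induced by a linear map. -/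
def linSubst (T : (Fin n → k) →ₗ[k] (Fin n → k)) :
    MvPolynomial (Fin n) k →ₐ[k] MvPolynomial (Fin n) k :=
  aeval fun i => linForm k n (T (Pi.single i 1))

theorem linSubst_X (T : (Fin n → k) →ₗ[k] (Fin n → k)) (i : Fin n) :
    linSubst T (X i) = linForm k n (T (Pi.single i 1)) := by
  simp [linSubst]

theorem linSubst_linForm (T : (Fin n → k) →ₗ[k] (Fin n → k)) (v : Fin n → k) :
    linSubst T (linForm k n v) = linForm k n (T v) := by
  have : (linSubst T).toLinearMap ∘ₗ linForm k n = linForm k n ∘ₗ T := by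
    refine LinearMap.pi_ext' fun i => LinearMap.ext_ring ?_
    simp [linForm_single, linSubst_X]
  exact congrArg (fun f => f v) this

theorem linSubst_comp (S T : (Fin n → k) →ₗ[k] (Fin n → k)) :
    (linSubst S).comp (linSubst T) = linSubst (S ∘ₗ T) := by
  ext1 i
  simp [linSubst_X, linSubst_linForm]

/-- A chosen linear projection with kernel `W`. -/
def projKer (W : Submodule k (Fin n → k)) : (Fin n → k) →ₗ[k] (Fin n → k) :=
  (W.exists_isCompl.choose).projection W W.exists_isCompl.choose_spec.symm

theorem ker_projKer (W : Submodule k (Fin n → k)) : LinearMap.ker (projKer W) = W :=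
  Submodule.ker_projection _

theorem projKer_eq_zero_iff {W : Submodule k (Fin n → k)} {v : Fin n → k} :
    projKer W v = 0 ↔ v ∈ W := by
  rw [← LinearMap.mem_ker, ker_projKer]

theorem sub_projKer_mem (W : Submodule k (Fin n → k)) (v : Fin n → k) : v - projKer W v ∈ W :=
  Submodule.sub_projection_mem _ v

theorem projKer_comp_projKer {W W' : Submodule k (Fin n → k)} (h : W ≤ W') :
    projKer W' ∘ₗ projKer W = projKer W' := by
  ext1 i
  ext1
  have := projKer_eq_zero_iff.2 (h (sub_projKer_mem W (Pi.single i 1)))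
  rw [map_sub, sub_eq_zero] at this
  simpa using this.symm

end Field

variable (p : Ideal R) [p.IsPrime]

/-- The prime ideal over `p` generated, over the residue field, by a space of linear forms. -/
def linPrime (W : Submodule p.ResidueField (Fin n → p.ResidueField)) :
    Ideal (MvPolynomial (Fin n) R) :=
  RingHom.ker ((linSubst (projKer W) : _ →+* MvPolynomial (Fin n) p.ResidueField).comp
    (MvPolynomial.map (algebraMap R p.ResidueField)))

/-- Reduction of a vector to the residue field. -/
def resVec (v : Fin n → R) : Fin n → p.ResidueField := fun i => algebraMap R p.ResidueField (v i)

instance linPrime_isPrime (W : Submodule p.ResidueField (Fin n → p.ResidueField)) :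
    (linPrime p W).IsPrime := RingHom.ker_isPrime _

variable {p}

theorem mem_linPrime_iff {W : Submodule p.ResidueField (Fin n → p.ResidueField)}
    {f : MvPolynomial (Fin n) R} : f ∈ linPrime p W ↔
      linSubst (projKer W) (MvPolynomial.map (algebraMap R p.ResidueField) f) = 0 := Iff.rfl

theorem comap_C_linPrime (W : Submodule p.ResidueField (Fin n → p.ResidueField)) :
    (linPrime p W).comap C = p := by
  ext x
  rw [Ideal.mem_comap, mem_linPrime_iff, map_C, ← algebraMap_eq, AlgHom.commutes, algebraMap_eq,
    C_eq_zero, Ideal.algebraMap_residueField_eq_zero]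

theorem linForm_mem_linPrime_iff {W : Submodule p.ResidueField (Fin n → p.ResidueField)}
    {v : Fin n → R} : linForm R n v ∈ linPrime p W ↔ resVec p v ∈ W := by
  rw [mem_linPrime_iff, map_linForm, linSubst_linForm,
    map_eq_zero_iff _ linForm_injective, projKer_eq_zero_iff]
  rfl

theorem linPrime_mono {W W' : Submodule p.ResidueField (Fin n → p.ResidueField)} (h : W ≤ W') :
    linPrime p W ≤ linPrime p W' := by
  intro f hf
  rw [mem_linPrime_iff] at hf ⊢
  rw [← projKer_comp_projKer h, ← linSubst_comp, AlgHom.comp_apply, hf, map_zero]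

theorem exists_smul_resVec (v : Fin n → p.ResidueField) :
    ∃ (c : p.ResidueField) (u : Fin n → R), c ≠ 0 ∧ c • v = resVec p u := by
  obtain ⟨b, hb⟩ := IsLocalization.exist_integer_multiples_of_finite
    (nonZeroDivisors (R ⧸ p)) v
  choose u hu using hb
  choose w hw using fun i => Ideal.Quotient.mk_surjective (u i)
  refine ⟨algebraMap (R ⧸ p) p.ResidueField b, w, ?_, ?_⟩
  · exact IsFractionRing.to_map_ne_zero_of_mem_nonZeroDivisors b.2
  · ext i
    have := hu i
    rw [Pi.smul_apply, smul_eq_mul, resVec, ← Ideal.algebraMap_quotient_residueField_mk, hw, this,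
      Algebra.smul_def]

theorem linPrime_lt {W W' : Submodule p.ResidueField (Fin n → p.ResidueField)} (h : W < W') :
    linPrime p W < linPrime p W' := by
  obtain ⟨v, hv', hv⟩ := SetLike.exists_of_lt h
  obtain ⟨c, u, hc, hu⟩ := exists_smul_resVec v
  refine lt_of_le_not_ge (linPrime_mono h.le) fun hle => hv ?_
  have h1 : resVec p u ∈ W' := hu ▸ W'.smul_mem c hv'
  have h2 := linForm_mem_linPrime_iff.1 (hle (linForm_mem_linPrime_iff.2 h1))
  rw [← hu] at h2
  exact (W.smul_mem_iff hc).1 h2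

theorem linPrime_le {Q : Ideal (MvPolynomial (Fin n) R)} [Q.IsPrime] (hQ : Q.comap C = p)
    {S : Set (Fin n → R)} (hS : ∀ v ∈ S, linForm R n v ∈ Q) :
    linPrime p (Submodule.span p.ResidueField (resVec p '' S)) ≤ Q := by
  set W := Submodule.span p.ResidueField (resVec p '' S)
  let χ : p.ResidueField →+* Q.ResidueField := Ideal.ResidueField.map p Q C hQ.symm
  have hχ : ∀ r, χ (algebraMap R _ r) = algebraMap _ Q.ResidueField (C r) := fun r =>
    Ideal.ResidueField.map_algebraMap _ _ _ _ _
  let θ : MvPolynomial (Fin n) p.ResidueField →+* Q.ResidueField :=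
    eval₂Hom χ fun i => algebraMap (MvPolynomial (Fin n) R) Q.ResidueField (X i)
  have hθ : ∀ f : MvPolynomial (Fin n) R,
      θ (MvPolynomial.map (algebraMap R p.ResidueField) f) = algebraMap _ Q.ResidueField f := by
    intro f
    have : θ.comp (MvPolynomial.map (algebraMap R p.ResidueField)) =
        algebraMap (MvPolynomial (Fin n) R) Q.ResidueField := by
      ext
      · simp [θ, hχ]
      · simp [θ]
    exact congrArg (fun g => g f) this
  have hθW : ∀ w ∈ W, θ (linForm _ n w) = 0 := by
    intro w hw
    induction hw using Submodule.span_induction with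
    | mem w hw =>
      obtain ⟨v, hv, rfl⟩ := hw
      have := hθ (linForm R n v)
      rw [map_linForm, Ideal.algebraMap_residueField_eq_zero.2 (hS v hv)] at this
      exact this
    | zero => simp
    | add x y _ _ hx hy => rw [map_add, map_add, hx, hy, add_zero]
    | smul c x _ hx => rw [map_smul, smul_eq_C_mul, map_mul, hx, mul_zero]
  have hT : ∀ f, θ (linSubst (projKer W) f) = θ f := by
    intro f
    have : θ.comp (linSubst (projKer W) : _ →+* MvPolynomial (Fin n) p.ResidueField) = θ := by
      refine MvPolynomial.ringHom_ext (fun c => ?_) fun i => ?_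
      · rw [RingHom.comp_apply, ← algebraMap_eq]
        exact congrArg θ ((linSubst (projKer W)).commutes c)
      · rw [RingHom.comp_apply]
        have := hθW _ (sub_projKer_mem W (Pi.single i 1))
        rw [map_sub, map_sub, linForm_single, sub_eq_zero] at this
        rw [this]
        exact congrArg θ (linSubst_X _ i)
    exact congrArg (fun g => g f) this
  intro f hf
  rw [mem_linPrime_iff] at hf
  rw [← Ideal.algebraMap_residueField_eq_zero, ← hθ, ← hT, hf, map_zero]

end LinearPrimes

theorem height_add_le_of_strictMono {k V : Type*} [Field k] [AddCommGroup V] [Module k V]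
    [FiniteDimensional k V] {B : Type*} [CommRing B] (F : Submodule k V → Ideal B)
    {W₀ : Submodule k V} (hprime : ∀ W, W₀ ≤ W → (F W).IsPrime)
    (hlt : ∀ W W', W₀ ≤ W → W < W' → F W < F W') (d : ℕ) {W W' : Submodule k V} (h₀ : W₀ ≤ W)
    (hle : W ≤ W') (hd : Module.finrank k W + d ≤ Module.finrank k W') :
    (F W).height + d ≤ (F W').height := by
  induction d generalizing W with
  | zero =>
    rw [Nat.cast_zero, add_zero]
    rcases hle.eq_or_lt with rfl | h
    · exact le_rfl
    · exact Ideal.height_mono (hlt W W' h₀ h).le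
  | succ d ih =>
    have hne : W < W' := lt_of_le_of_ne hle (by rintro rfl; omega)
    obtain ⟨v, hv', hv⟩ := SetLike.exists_of_lt hne
    have hlt1 : W < W ⊔ Submodule.span k {v} :=
      lt_of_le_not_ge le_sup_left fun hge =>
        hv (hge (Submodule.mem_sup_right (Submodule.mem_span_singleton_self v)))
    have hfin : Module.finrank k (W ⊔ Submodule.span k {v} : Submodule k V) ≤
        Module.finrank k W + 1 :=
      (Submodule.finrank_add_le_finrank_add_finrank _ _).trans
        (Nat.add_le_add_left (finrank_span_le_card ({v} : Set V) |>.trans (by simp)) _)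
    have h1 := ih (W := W ⊔ Submodule.span k {v}) (h₀.trans hlt1.le)
      (sup_le hle ((Submodule.span_singleton_le_iff_mem _ _).2 hv')) (by omega)
    have := hprime W h₀
    have := hprime _ (h₀.trans hlt1.le)
    have h2 := Ideal.height_add_one_le_of_lt_of_isPrime (hlt _ _ h₀ hlt1)
    calc (F W).height + ((d + 1 : ℕ) : ℕ∞) = (F W).height + 1 + d := by
          push_cast; rw [add_assoc, add_comm 1]
      _ ≤ _ := by gcongr
      _ ≤ _ := h1

open MvPolynomial in
theorem height_add_finrank_le {R : Type*} [CommRing R] [IsNoetherianRing R] {n : ℕ} (p : Ideal R)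
    [p.IsPrime] {Q : Ideal (MvPolynomial (Fin n) R)} [Q.IsPrime] (hQ : Q.comap C = p)
    {S : Set (Fin n → R)} (hS : ∀ v ∈ S, linForm R n v ∈ Q) :
    p.height + Module.finrank p.ResidueField (Submodule.span p.ResidueField (resVec p '' S)) ≤
      Q.height := by
  refine le_trans ?_ (Ideal.height_mono (linPrime_le hQ hS))
  refine le_trans ?_ (height_add_le_of_strictMono (linPrime p) (W₀ := ⊥)
    (fun W _ => inferInstance) (fun W W' _ h => linPrime_lt h) _ le_rfl bot_le
    (by rw [finrank_bot, zero_add]))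
  gcongr
  have : (linPrime p (⊥ : Submodule p.ResidueField (Fin n → p.ResidueField))).LiesOver p :=
    ⟨(comap_C_linPrime _).symm⟩
  rw [Ideal.height_eq_height_add_of_liesOver_of_hasGoingDown p
    (linPrime p (⊥ : Submodule p.ResidueField (Fin n → p.ResidueField)))]
  exact le_self_add

section Minors

theorem exists_linearIndependent_comp {k V ι : Type*} [Field k] [AddCommGroup V] [Module k V]
    [Finite ι] (v : ι → V) {t : ℕ}
    (ht : t ≤ Module.finrank k (Submodule.span k (Set.range v))) :
    ∃ g : Fin t → ι, LinearIndependent k (v ∘ g) := by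
  obtain ⟨κ, a, ha, hspan, hli⟩ := exists_linearIndependent' k v
  have : Finite κ := Finite.of_injective a ha
  have := Fintype.ofFinite κ
  rw [← hspan, finrank_span_eq_card hli] at ht
  obtain ⟨f⟩ := Function.Embedding.nonempty_of_card_le (α := Fin t) (β := κ) (by simpa using ht)
  exact ⟨a ∘ f, hli.comp f f.injective⟩

theorem Matrix.le_rank_iff_exists_det_ne_zero {k m l : Type*} [Field k] [Fintype m] [Fintype l]
    (M : Matrix m l k) (t : ℕ) :
    t ≤ M.rank ↔ ∃ (f : Fin t → m) (g : Fin t → l), (M.submatrix f g).det ≠ 0 := by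
  constructor
  · intro h
    rw [Matrix.rank_eq_finrank_span_cols] at h
    obtain ⟨g, hg⟩ := exists_linearIndependent_comp _ h
    have h1 : (M.submatrix id g).rank = t := by
      rw [← Matrix.rank_transpose, LinearIndependent.rank_matrix]
      · simp
      · exact hg
    rw [← Matrix.rank_transpose, Matrix.rank_eq_finrank_span_cols] at h1
    obtain ⟨f, hf⟩ := exists_linearIndependent_comp _ h1.ge
    refine ⟨f, g, fun h0 => ?_⟩
    have h2 : LinearIndependent k (M.submatrix f g).row := hf
    rw [Matrix.linearIndependent_rows_iff_isUnit, Matrix.isUnit_iff_isUnit_det, h0] at h2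
    exact not_isUnit_zero h2
  · rintro ⟨f, g, h⟩
    have := Matrix.rank_of_det_ne_zero h
    rw [Fintype.card_fin] at this
    exact this ▸ Matrix.rank_submatrix_le M f g

variable {R : Type} [CommRing R] {n s : ℕ}

/-- The reduction of the column space of `φ` at `p`. -/
def colSpace (φ : Matrix (Fin n) (Fin s) R) (p : Ideal R) [p.IsPrime] :
    Submodule p.ResidueField (Fin n → p.ResidueField) :=
  Submodule.span _ (resVec p '' Set.range φ.col)

theorem rank_map_eq_finrank_colSpace (φ : Matrix (Fin n) (Fin s) R) (p : Ideal R) [p.IsPrime] :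
    (φ.map (algebraMap R p.ResidueField)).rank = Module.finrank p.ResidueField (colSpace φ p) := by
  rw [Matrix.rank_eq_finrank_span_cols, colSpace, ← Set.range_comp]
  rfl

theorem minorsIdeal_le_iff_s8 (φ : Matrix (Fin n) (Fin s) R) (p : Ideal R) [p.IsPrime] (t : ℕ) :
    minorsIdeal φ t ≤ p ↔ Module.finrank p.ResidueField (colSpace φ p) < t := by
  rw [← not_le, ← rank_map_eq_finrank_colSpace, Matrix.le_rank_iff_exists_det_ne_zero,
    minorsIdeal, Ideal.span_le]
  have key : ∀ f g, (((φ.map (algebraMap R p.ResidueField)).submatrix f g).det : p.ResidueField) =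
      algebraMap R p.ResidueField (φ.submatrix (f : Fin t → Fin n) g).det := by
    intro f g
    rw [RingHom.map_det, RingHom.mapMatrix_apply, Matrix.submatrix_map]
  simp only [key, Ne, Ideal.algebraMap_residueField_eq_zero]
  push Not
  constructor
  · exact fun h f g => h ⟨f, g, rfl⟩
  · rintro h _ ⟨f, g, rfl⟩
    exact h f g

theorem idealHeight_le_height {I p : Ideal R} [hp : p.IsPrime] (h : I ≤ p) :
    idealHeight I ≤ p.height := by
  refine (iInf₂_le (⟨p, hp⟩ : PrimeSpectrum R) h).trans ?_
  exact (PrimeSpectrum.height_eq_orderHeight ⟨p, hp⟩).ge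

theorem le_idealHeight_iff {I : Ideal R} {a : ℕ∞} :
    a ≤ idealHeight I ↔ ∀ (p : Ideal R) [p.IsPrime], I ≤ p → a ≤ p.height := by
  constructor
  · exact fun h p _ hI => h.trans (idealHeight_le_height hI)
  · intro h
    refine le_iInf₂ fun p hp => ?_
    rw [← PrimeSpectrum.height_eq_orderHeight]
    exact h _ hp

end Minors

section SymmetricAlgebra

open MvPolynomial

variable {R E : Type} [CommRing R] [AddCommGroup E] [Module R E]

/-- The canonical map from a module to its symmetric algebra. -/
def symmι (R E : Type) [CommRing R] [AddCommGroup E] [Module R E] : E →ₗ[R] SymmAlgebra R E where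
  toFun x := Ideal.Quotient.mk _ (X x)
  map_add' x y := by
    rw [← map_add, Ideal.Quotient.mk_eq_mk_iff_sub_mem]
    exact Ideal.subset_span (Or.inl ⟨x, y, by ring⟩)
  map_smul' r x := by
    change Ideal.Quotient.mk _ _ = Ideal.Quotient.mk _ (r • X x)
    rw [Ideal.Quotient.mk_eq_mk_iff_sub_mem, smul_eq_C_mul]
    exact Ideal.subset_span (Or.inr ⟨r, x, rfl⟩)

/-- The universal property of the symmetric algebra. -/
def symmLift {B : Type*} [CommRing B] [Algebra R B] (f : E →ₗ[R] B) : SymmAlgebra R E →ₐ[R] B :=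
  Ideal.Quotient.liftₐ _ (aeval f) fun a ha => by
    have : Ideal.span (symRels R E) ≤ RingHom.ker (aeval f : MvPolynomial E R →ₐ[R] B) := by
      rw [Ideal.span_le]
      rintro _ (⟨x, y, rfl⟩ | ⟨r, x, rfl⟩)
      · simp [RingHom.mem_ker]
      · simp [RingHom.mem_ker, Algebra.smul_def]
    exact this ha

@[simp]
theorem symmLift_symmι {B : Type*} [CommRing B] [Algebra R B] (f : E →ₗ[R] B) (x : E) :
    symmLift f (symmι R E x) = f x := by
  change aeval f (X x : MvPolynomial E R) = f x
  simp

theorem symmAlgebra_algHom_ext {B : Type*} [CommRing B] [Algebra R B]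
    {f g : SymmAlgebra R E →ₐ[R] B} (h : ∀ x, f (symmι R E x) = g (symmι R E x)) : f = g := by
  refine Ideal.Quotient.algHom_ext _ ?_
  ext x
  exact h x

variable {n : ℕ}

/-- The ideal generated by the linear forms with coefficient vectors in `K`. -/
def linIdeal (K : Submodule R (Fin n → R)) : Ideal (MvPolynomial (Fin n) R) :=
  Ideal.span (linForm R n '' K)

theorem linIdeal_span (S : Set (Fin n → R)) :
    linIdeal (Submodule.span R S) = Ideal.span (linForm R n '' S) := by
  refine le_antisymm (Ideal.span_le.2 ?_) (Ideal.span_mono (Set.image_mono Submodule.subset_span))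
  rintro _ ⟨v, hv, rfl⟩
  induction hv using Submodule.span_induction with
  | mem v hv => exact Ideal.subset_span ⟨v, hv, rfl⟩
  | zero => simp
  | add x y _ _ hx hy =>
    rw [map_add]
    exact add_mem hx hy
  | smul c x _ hx =>
    rw [map_smul, smul_eq_C_mul]
    exact Ideal.mul_mem_left _ _ hx

/-- The presentation of the symmetric algebra induced by a presentation of the module. -/
def symmEquiv (g : (Fin n → R) →ₗ[R] E) (hg : Function.Surjective g) :
    SymmAlgebra R E ≃ₐ[R] MvPolynomial (Fin n) R ⧸ linIdeal (LinearMap.ker g) := by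
  let f₀ : (Fin n → R) →ₗ[R] MvPolynomial (Fin n) R ⧸ linIdeal (LinearMap.ker g) :=
    (Ideal.Quotient.mkₐ R (linIdeal (LinearMap.ker g))).toLinearMap ∘ₗ linForm R n
  have hf₀ : LinearMap.ker g ≤ LinearMap.ker f₀ := fun v hv =>
    Ideal.Quotient.eq_zero_iff_mem.2 (Ideal.subset_span ⟨v, hv, rfl⟩)
  let f₁ : E →ₗ[R] MvPolynomial (Fin n) R ⧸ linIdeal (LinearMap.ker g) :=
    (LinearMap.ker g).liftQ f₀ hf₀ ∘ₗ (g.quotKerEquivOfSurjective hg).symm.toLinearMap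
  have hf₁ : ∀ v, f₁ (g v) = f₀ v := fun v => by
    have : (g.quotKerEquivOfSurjective hg).symm (g v) = Submodule.Quotient.mk v := by
      rw [LinearEquiv.symm_apply_eq]
      rfl
    simp [f₁, this]
  let F : MvPolynomial (Fin n) R →ₐ[R] SymmAlgebra R E :=
    aeval fun i => symmι R E (g (Pi.single i 1))
  have hF : ∀ v, F (linForm R n v) = symmι R E (g v) := by
    have : F.toLinearMap ∘ₗ linForm R n = symmι R E ∘ₗ g := by
      refine LinearMap.pi_ext' fun i => LinearMap.ext_ring ?_
      simp [linForm_single, F]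
    exact fun v => congrArg (fun h => h v) this
  refine AlgEquiv.ofAlgHom (symmLift f₁) (Ideal.Quotient.liftₐ _ F fun a ha => ?_) ?_ ?_
  · have : linIdeal (LinearMap.ker g) ≤ RingHom.ker F := by
      rw [linIdeal, Ideal.span_le]
      rintro _ ⟨v, hv, rfl⟩
      rw [SetLike.mem_coe, RingHom.mem_ker, hF, LinearMap.mem_ker.1 hv, map_zero]
    exact this ha
  · refine Ideal.Quotient.algHom_ext _ ?_
    ext i
    have h1 : F (X i) = symmι R E (g (Pi.single i 1)) := by simp [F]
    have h2 : f₁ (g (Pi.single i 1)) = Ideal.Quotient.mk _ (X i) := by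
      rw [hf₁]
      simp [f₀, linForm_single]
    change symmLift f₁ (F (X i)) = _
    rw [h1, symmLift_symmι, h2]
    rfl
  · refine symmAlgebra_algHom_ext fun x => ?_
    obtain ⟨v, rfl⟩ := hg x
    have h3 : f₁ (g v) = Ideal.Quotient.mk _ (linForm R n v) := by
      rw [hf₁]
      rfl
    rw [AlgHom.comp_apply, symmLift_symmι, h3]
    exact hF v

end SymmetricAlgebra

theorem regSeqMod_append_singleton_iff {A : Type*} [CommRing A] {J : Ideal A} {rs : List A}
    {x : A} : RegSeqMod J (rs ++ [x]) ↔
      RegSeqMod J rs ∧ IsRegularMod (J ⊔ Ideal.ofList rs) x := by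
  induction rs generalizing J with
  | nil => simp [RegSeqMod]
  | cons y rs ih => rw [List.cons_append, RegSeqMod, ih, RegSeqMod, sup_ofList_cons, and_assoc]

theorem le_of_mem_associatedPrimes_quotient {A : Type*} [CommRing A] {J Q : Ideal A}
    (hQ : Q ∈ associatedPrimes A (A ⧸ J)) : J ≤ Q := by
  have := IsAssociatedPrime.annihilator_le hQ
  rwa [Submodule.annihilator_top, Ideal.annihilator_quotient] at this

theorem HeightLEGrade.regSeqMod {A : Type*} [CommRing A] [IsNoetherianRing A]
    (hA : HeightLEGrade A) (rs : List A)
    (h : ∀ (Q : Ideal A) [Q.IsPrime] (i : ℕ), i ≤ rs.length → (∀ r ∈ rs.take i, r ∈ Q) →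
      (i : ℕ∞) ≤ Q.height) : RegSeqMod ⊥ rs := by
  induction rs using List.reverseRecOn with
  | nil => trivial
  | append_singleton rs x ih =>
    have hrs : RegSeqMod ⊥ rs := by
      refine ih fun Q _ i hi hQ => h Q i (by simp; omega) ?_
      rwa [List.take_append_of_le_length hi]
    refine regSeqMod_append_singleton_iff.2 ⟨hrs, ?_⟩
    rw [isRegularMod_iff]
    intro Q hQ hx
    have := IsAssociatedPrime.isPrime hQ
    have hrsQ : ∀ r ∈ rs, r ∈ Q := fun r hr => le_of_mem_associatedPrimes_quotient hQ
      (Ideal.mem_sup_right (Ideal.subset_span hr))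
    have h1 := hA Q (rs.length + 1) (h Q _ (by simp) (by
      intro r hr
      rcases List.mem_append.1 (List.mem_of_mem_take hr) with hr | hr
      · exact hrsQ r hr
      · rw [List.mem_singleton.1 hr]
        exact hx))
    exact not_hasGrade_of_mem_associatedPrimes hQ one_ne_zero (hrs.hasGrade_sup hrsQ h1)

section

variable {R E : Type} [CommRing R] [AddCommGroup E] [Module R E]

open TensorProduct in
theorem hasRank.add_le [IsNoetherianRing R] [Nontrivial R] {e n s : ℕ}
    (hrk : hasRank R E e) (f : (Fin s → R) →ₗ[R] (Fin n → R)) (g : (Fin n → R) →ₗ[R] E)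
    (hg : Function.Surjective g) (hgf : g ∘ₗ f = 0) (hf : Function.Injective f) : s + e ≤ n := by
  obtain ⟨p, hp⟩ := associatedPrimes.nonempty R R
  have := IsAssociatedPrime.isPrime hp
  obtain ⟨hfree, hfin⟩ := hrk p this hp
  let K := Localization.AtPrime p
  let eqv : LocalizedModule p.primeCompl E ≃ₗ[K] K ⊗[R] E :=
    (IsLocalizedModule.isBaseChange p.primeCompl K
      (LocalizedModule.mkLinearMap p.primeCompl E)).equiv.symm
  have : Module.Free K (K ⊗[R] E) := Module.Free.of_equiv eqv
  have hE : Module.finrank K (K ⊗[R] E) = e := by rw [← eqv.finrank_eq, hfin]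
  have hfK : Function.Injective (f.baseChange K) :=
    Module.Flat.lTensor_preserves_injective_linearMap (M := K) f hf
  have hgK : Function.Surjective (g.baseChange K) := LinearMap.lTensor_surjective K hg
  have hgfK : ∀ x, g.baseChange K (f.baseChange K x) = 0 := by
    intro x
    rw [← LinearMap.comp_apply, ← LinearMap.baseChange_comp, hgf]
    simp
  obtain ⟨σ, hσ⟩ := Module.projective_lifting_property (g.baseChange K) LinearMap.id hgK
  have : Module.Finite K (K ⊗[R] (Fin n → R)) := inferInstance
  have : Module.Finite R E := Module.Finite.of_surjective g hg
  have hinj : Function.Injective ((f.baseChange K).coprod σ) := by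
    refine (injective_iff_map_eq_zero _).2 fun ⟨x, y⟩ hxy => ?_
    rw [LinearMap.coprod_apply] at hxy
    have hy : y = 0 := by
      have := congrArg (g.baseChange K) hxy
      rw [map_add, hgfK, zero_add, map_zero] at this
      exact (congrArg (fun h => h y) hσ).symm.trans this
    rw [hy, map_zero, add_zero] at hxy
    rw [hy, (injective_iff_map_eq_zero _).1 hfK x hxy]
    rfl
  have := LinearMap.finrank_le_finrank_of_injective hinj
  rwa [Module.finrank_prod, hE, Module.finrank_baseChange, Module.finrank_baseChange,
    Module.finrank_fin_fun, Module.finrank_fin_fun] at this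

theorem finrank_span_range_le {k V : Type*} [Field k] [AddCommGroup V] [Module k V] {s : ℕ}
    (c : Fin s → V) {i : ℕ} (hi : i ≤ s) : Module.finrank k (Submodule.span k (Set.range c)) ≤
      Module.finrank k (Submodule.span k (c '' {j | (j : ℕ) < i})) + (s - i) := by
  classical
  have hsp : Submodule.span k (Set.range c) = Submodule.span k (c '' {j | (j : ℕ) < i}) ⊔
      Submodule.span k (c '' {j | (j : ℕ) < i}ᶜ) := by
    rw [← Submodule.span_union, ← Set.image_union, Set.union_compl_self, Set.image_univ]
  have : FiniteDimensional k (Submodule.span k (c '' {j | (j : ℕ) < i})) :=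
    FiniteDimensional.span_of_finite k (Set.toFinite _)
  have : FiniteDimensional k (Submodule.span k (c '' {j | (j : ℕ) < i}ᶜ)) :=
    FiniteDimensional.span_of_finite k (Set.toFinite _)
  rw [hsp]
  refine (Submodule.finrank_add_le_finrank_add_finrank _ _).trans (Nat.add_le_add_left ?_ _)
  refine (finrank_span_le_card _).trans ?_
  rw [Set.toFinset_image]
  refine Finset.card_image_le.trans ?_
  rw [Set.toFinset_compl, Finset.card_compl, Fintype.card_fin]
  have hcard : ({j : Fin s | (j : ℕ) < i} : Set (Fin s)).toFinset.card = i := by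
    rw [← Fintype.card_fin i, ← Finset.card_univ]
    refine (Finset.card_bij (fun j _ => Fin.castLE hi j) ?_ ?_ ?_).symm
    · simp
    · intro a _ b _ h
      exact Fin.castLE_injective hi h
    · intro b hb
      exact ⟨⟨b, by simpa using hb⟩, by simp, rfl⟩
  rw [hcard]

open MvPolynomial in
theorem exists_isRegular_of_le_idealHeight [IsNoetherianRing R] [Nontrivial R]
    (hR : HeightLEGrade R) {e n s : ℕ} (hrk : hasRank R E e) (φ : Matrix (Fin n) (Fin s) R)
    (g : (Fin n → R) →ₗ[R] E) (hg : Function.Surjective g)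
    (hker : LinearMap.ker g = LinearMap.range φ.mulVecLin) (hinj : Function.Injective φ.mulVecLin)
    (hF : ∀ i : ℕ, e ≤ i → ((i - e + 1 : ℕ) : ℕ∞) ≤ idealHeight (minorsIdeal φ (n - i))) :
    ∃ rs : List (MvPolynomial (Fin n) R),
      RingTheory.Sequence.IsRegular (MvPolynomial (Fin n) R) rs ∧
      Nonempty (SymmAlgebra R E ≃ₐ[R] (MvPolynomial (Fin n) R ⧸ Ideal.ofList rs)) := by
  have hse : s + e ≤ n := hrk.add_le φ.mulVecLin g hg
    (LinearMap.ext fun x => by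
      have : φ.mulVecLin x ∈ LinearMap.ker g := hker ▸ ⟨x, rfl⟩
      exact this) hinj
  have hrank : ∀ (p : Ideal R) [p.IsPrime],
      (s : ℕ∞) ≤ p.height + Module.finrank p.ResidueField (colSpace φ p) := by
    intro p _
    by_cases hρ : s ≤ Module.finrank p.ResidueField (colSpace φ p)
    · exact (Nat.cast_le.2 hρ).trans le_add_self
    set ρ := Module.finrank p.ResidueField (colSpace φ p)
    have h1 := hF (n - (ρ + 1)) (by omega)
    rw [show n - (n - (ρ + 1)) = ρ + 1 by omega] at h1
    have h2 := h1.trans (idealHeight_le_height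
      ((minorsIdeal_le_iff_s8 φ p (ρ + 1)).2 (Nat.lt_succ_self _)))
    calc (s : ℕ∞) ≤ ((n - (ρ + 1) - e + 1 : ℕ) : ℕ∞) + ρ := by
          rw [← Nat.cast_add, Nat.cast_le]; omega
      _ ≤ _ := by gcongr
  set rs := List.ofFn fun j => linForm R n (φ.col j) with hrs
  have hlist : Ideal.ofList rs = linIdeal (LinearMap.ker g) := by
    rw [hker, Matrix.range_mulVecLin, linIdeal_span, ← Set.range_comp, Ideal.ofList]
    congr 1
    ext x
    simp [hrs, List.mem_ofFn]
  refine ⟨rs, ⟨regSeqMod_bot_iff.1 ?_, ?_⟩, ⟨(symmEquiv g hg).trans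
    (Ideal.quotientEquivAlgOfEq R hlist.symm)⟩⟩
  · refine (hR.mvPolynomial n).regSeqMod rs fun Q _ i hi hQ => ?_
    have hi' : i ≤ s := by simpa [hrs] using hi
    set p := Q.comap C with hp
    have h1 := height_add_finrank_le p hp.symm (S := φ.col '' {j | (j : ℕ) < i}) (by
      rintro _ ⟨j, hj, rfl⟩
      refine hQ _ (List.mem_take_iff_getElem.2 ⟨j, ?_, ?_⟩)
      · simpa [hrs] using hj
      · simp [hrs])
    have h2 := finrank_span_range_le (k := p.ResidueField) (fun j => resVec p (φ.col j)) hi'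
    have h3 := hrank p
    rw [colSpace, ← Set.range_comp] at h3
    rw [← Set.image_comp] at h1
    obtain ⟨h, hh⟩ : ∃ h : ℕ, p.height = h := by
      refine ENat.ne_top_iff_exists.1 ?_ |>.imp fun _ => Eq.symm
      exact Ideal.height_ne_top_of_isPrime
    rw [hh] at h1 h3
    refine le_trans ?_ h1
    norm_cast at h3 ⊢
    simp only [Function.comp_def] at h3 h2 ⊢
    omega
  · rw [smul_eq_mul, Ideal.mul_top]
    have : Ideal.ofList rs ≤
        RingHom.ker (aeval (0 : Fin n → R) : MvPolynomial (Fin n) R →ₐ[R] R) := by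
      rw [Ideal.ofList, Ideal.span_le]
      intro x hx
      obtain ⟨j, rfl⟩ := (List.mem_ofFn' _ _).1 hx
      simp [RingHom.mem_ker, linForm_apply]
    intro h
    exact RingHom.ker_ne_top _ (top_le_iff.1 (h.trans_le this))

end

theorem RegSeqMod.length_le_height {A : Type*} [CommRing A] [IsNoetherianRing A] {rs : List A}
    (h : RegSeqMod ⊥ rs) (Q : Ideal A) [Q.IsPrime] (hQ : ∀ r ∈ rs, r ∈ Q) :
    (rs.length : ℕ∞) ≤ Q.height := by
  induction rs using List.reverseRecOn generalizing Q with
  | nil => simp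
  | append_singleton rs x ih =>
    obtain ⟨hrs, hx⟩ := regSeqMod_append_singleton_iff.1 h
    rw [bot_sup_eq] at hx
    obtain ⟨Q', hQ', hle⟩ := Ideal.exists_minimalPrimes_le (I := Ideal.ofList rs) (J := Q)
      (Ideal.span_le.2 fun r hr => hQ r (by simpa using Or.inl hr))
    have hQ'prime : Q'.IsPrime := hQ'.1.1
    have hass : Q' ∈ associatedPrimes A (A ⧸ Ideal.ofList rs) := by
      refine Module.associatedPrimes.minimalPrimes_annihilator_subset_associatedPrimes A _ ?_
      rwa [Ideal.annihilator_quotient]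
    have hlt : Q' < Q := lt_of_le_of_ne hle (by
      rintro rfl
      exact isRegularMod_iff.1 hx _ hass (hQ x (by simp)))
    have h1 := ih hrs Q' fun r hr => hQ'.1.2 (Ideal.subset_span hr)
    calc ((rs ++ [x]).length : ℕ∞) = rs.length + 1 := by simp
      _ ≤ Q'.height + 1 := by gcongr
      _ ≤ Q.height := Ideal.height_add_one_le_of_lt_of_isPrime hlt

section

open MvPolynomial

variable {R E : Type} [CommRing R] [AddCommGroup E] [Module R E]

open TensorProduct in
theorem finrank_linearMap_residueField {e : ℕ} [Module.Finite R E] (p : Ideal R) [p.IsPrime]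
    (hfree : Module.Free (Localization.AtPrime p) (LocalizedModule p.primeCompl E))
    (hfin : Module.finrank (Localization.AtPrime p) (LocalizedModule p.primeCompl E) = e) :
    Module.finrank p.ResidueField (E →ₗ[R] p.ResidueField) = e := by
  let K := Localization.AtPrime p
  let κ := p.ResidueField
  let eqv : LocalizedModule p.primeCompl E ≃ₗ[K] K ⊗[R] E :=
    (IsLocalizedModule.isBaseChange p.primeCompl K
      (LocalizedModule.mkLinearMap p.primeCompl E)).equiv.symm
  have : Module.Free K (K ⊗[R] E) := Module.Free.of_equiv eqv
  have hE : Module.finrank K (K ⊗[R] E) = e := by rw [← eqv.finrank_eq, hfin]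
  have h1 : Module.finrank κ (κ ⊗[R] E) = e := by
    rw [← (TensorProduct.AlgebraTensorModule.cancelBaseChange R K κ κ E).finrank_eq,
      Module.finrank_baseChange, hE]
  rw [(LinearMap.liftBaseChangeEquiv κ).finrank_eq, ← h1]
  exact Subspace.dual_finrank_eq

/-- The derivation of a polynomial ring over `α` with prescribed values at the variables. -/
def pderivComb {N : ℕ} {κ : Type*} [Field κ] [Algebra R κ] (α : MvPolynomial (Fin N) R →ₐ[R] κ) :
    (Fin N → κ) →ₗ[κ] (MvPolynomial (Fin N) R →ₗ[R] κ) :=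
  Fintype.linearCombination κ fun i => α.toLinearMap ∘ₗ (pderiv (R := R) i).toLinearMap

section

variable {N : ℕ} {κ : Type*} [Field κ] [Algebra R κ] (α : MvPolynomial (Fin N) R →ₐ[R] κ)

theorem pderivComb_apply (w : Fin N → κ) (f : MvPolynomial (Fin N) R) :
    pderivComb α w f = ∑ i, w i * α (pderiv i f) := by
  simp [pderivComb, Fintype.linearCombination_apply]

theorem pderivComb_mul (w : Fin N → κ) (f h : MvPolynomial (Fin N) R) :
    pderivComb α w (f * h) = α f * pderivComb α w h + α h * pderivComb α w f := by
  simp only [pderivComb_apply, Derivation.leibniz, smul_eq_mul, map_add, map_mul, Finset.mul_sum,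
    ← Finset.sum_add_distrib]
  exact Finset.sum_congr rfl fun i _ => by ring

theorem pderivComb_C (w : Fin N → κ) (a : R) : pderivComb α w (C a) = 0 := by
  simp [pderivComb_apply]

theorem pderivComb_X (w : Fin N → κ) (i : Fin N) : pderivComb α w (X i) = w i := by
  simp [pderivComb_apply, pderiv_X, Pi.single_apply, apply_ite α]

end

theorem le_length_add_finrank {N : ℕ} {rs : List (MvPolynomial (Fin N) R)} [Module.Finite R E]
    (ψ : SymmAlgebra R E ≃ₐ[R] (MvPolynomial (Fin N) R ⧸ Ideal.ofList rs))
    (κ : Type*) [Field κ] [Algebra R κ] [FiniteDimensional κ (E →ₗ[R] κ)] :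
    N ≤ rs.length + Module.finrank κ (E →ₗ[R] κ) := by
  set I := Ideal.ofList rs
  let α : MvPolynomial (Fin N) R →ₐ[R] κ := (Algebra.ofId R κ).comp
    ((symmLift (0 : E →ₗ[R] R)).comp (ψ.symm.toAlgHom.comp (Ideal.Quotient.mkₐ R I)))
  have hα : ∀ f ∈ I, α f = 0 := by
    intro f hf
    have : Ideal.Quotient.mkₐ R I f = 0 := Ideal.Quotient.eq_zero_iff_mem.2 hf
    simp only [α, AlgHom.comp_apply, this, map_zero]
  let ev : (Fin N → κ) →ₗ[κ] (Fin rs.length → κ) :=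
    { toFun := fun w j => pderivComb α w (rs.get j)
      map_add' := fun v w => by ext; simp
      map_smul' := fun c w => by ext; simp }
  have hD : ∀ w ∈ LinearMap.ker ev, ∀ f ∈ I, pderivComb α w f = 0 := by
    intro w hw f hf
    induction hf using Submodule.span_induction with
    | mem f hf =>
      obtain ⟨j, rfl⟩ := List.mem_iff_get.1 hf
      exact congrFun (LinearMap.mem_ker.1 hw) j
    | zero => simp
    | add x y _ _ hx hy => rw [map_add, hx, hy, add_zero]
    | smul c x hx' hx =>
      rw [smul_eq_mul, pderivComb_mul, hx, hα x hx', mul_zero, zero_mul, add_zero]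
  have hD' : ∀ w ∈ LinearMap.ker ev, ∀ f h, Ideal.Quotient.mk I f = Ideal.Quotient.mk I h →
      pderivComb α w f = pderivComb α w h := by
    intro w hw f h hfh
    rw [← sub_eq_zero, ← map_sub]
    exact hD w hw _ (Ideal.Quotient.mk_eq_mk_iff_sub_mem _ _ |>.1 hfh)
  choose β hβ using fun x : SymmAlgebra R E => Ideal.Quotient.mk_surjective (ψ x)
  let Λ : LinearMap.ker ev →ₗ[κ] (E →ₗ[R] κ) :=
    { toFun := fun w =>
        { toFun := fun x => pderivComb α w (β (symmι R E x))
          map_add' := fun x y => by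
            rw [← map_add]
            refine hD' w w.2 _ _ ?_
            rw [map_add (Ideal.Quotient.mk I), hβ, hβ, hβ, map_add, map_add]
          map_smul' := fun c x => by
            rw [RingHom.id_apply, ← map_smul]
            refine hD' w w.2 _ _ ?_
            rw [hβ, map_smul, map_smul, ← hβ]
            rfl }
      map_add' := fun v w => by ext; simp
      map_smul' := fun c w => by ext; simp }
  have hΛ : Function.Injective Λ := by
    refine (injective_iff_map_eq_zero _).2 fun w hw => ?_
    have hE : ∀ x, pderivComb α w (β (symmι R E x)) = 0 := fun x => congrArg (fun h => h x) hw
    have key : ∀ q : MvPolynomial E R,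
        pderivComb α (w : Fin N → κ) (β (Ideal.Quotient.mk _ q)) = 0 := by
      intro q
      induction q using MvPolynomial.induction_on with
      | C a =>
        rw [← pderivComb_C α w a]
        refine hD' w w.2 _ _ ?_
        rw [hβ]
        exact ψ.commutes a
      | add p q hp hq =>
        rw [← add_zero (0 : κ)]
        nth_rewrite 1 [← hp]
        rw [← hq, ← map_add]
        refine hD' w w.2 _ _ ?_
        rw [map_add (Ideal.Quotient.mk I), hβ, hβ, hβ, map_add, map_add]
      | mul_X p x hp =>
        have h1 : pderivComb α (w : Fin N → κ)
            (β (Ideal.Quotient.mk _ p) * β (symmι R E x)) = 0 := by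
          rw [pderivComb_mul, hp, hE, mul_zero, mul_zero, add_zero]
        rw [← h1]
        refine hD' w w.2 _ _ ?_
        rw [map_mul (Ideal.Quotient.mk I), hβ, hβ, hβ, map_mul, map_mul]
        rfl
    ext i
    obtain ⟨q, hq⟩ := Ideal.Quotient.mk_surjective (ψ.symm (Ideal.Quotient.mk I (X i)))
    rw [← pderivComb_X α w i, ← hD' w w.2 _ _ (show Ideal.Quotient.mk I (β _) = _ by
      rw [hβ (Ideal.Quotient.mk _ q), hq, AlgEquiv.apply_symm_apply]), key]
    rfl
  have h1 := LinearMap.finrank_le_finrank_of_injective hΛ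
  have h2 := LinearMap.finrank_range_add_finrank_ker ev
  have h3 := Submodule.finrank_le (LinearMap.range ev)
  rw [Module.finrank_fin_fun] at h2 h3
  omega

theorem le_height_add_finrank_colSpace [IsNoetherianRing R] {n s N : ℕ}
    (φ : Matrix (Fin n) (Fin s) R) (g : (Fin n → R) →ₗ[R] E) (hg : Function.Surjective g)
    (hker : LinearMap.ker g = LinearMap.range φ.mulVecLin) {rs : List (MvPolynomial (Fin N) R)}
    (hrs : RegSeqMod ⊥ rs)
    (ψ : SymmAlgebra R E ≃ₐ[R] (MvPolynomial (Fin N) R ⧸ Ideal.ofList rs))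
    (p : Ideal R) [p.IsPrime] : ((rs.length + n : ℕ) : ℕ∞) ≤
      p.height + N + Module.finrank p.ResidueField (colSpace φ p) := by
  let χ : MvPolynomial (Fin N) R →ₐ[R] MvPolynomial (Fin n) R ⧸ linIdeal (LinearMap.ker g) :=
    (ψ.symm.trans (symmEquiv g hg)).toAlgHom.comp (Ideal.Quotient.mkₐ R (Ideal.ofList rs))
  have hχ : Function.Surjective χ :=
    (ψ.symm.trans (symmEquiv g hg)).surjective.comp Ideal.Quotient.mk_surjective
  let π : MvPolynomial (Fin n) R →+* MvPolynomial (Fin n) R ⧸ linIdeal (LinearMap.ker g) :=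
    Ideal.Quotient.mk _
  have hπ : Function.Surjective π := Ideal.Quotient.mk_surjective
  have hle : ∀ W, colSpace φ p ≤ W → linIdeal (LinearMap.ker g) ≤ linPrime p W := by
    intro W hW
    rw [hker, Matrix.range_mulVecLin, linIdeal_span, Ideal.span_le]
    rintro _ ⟨v, hv, rfl⟩
    exact linForm_mem_linPrime_iff.2 (hW (Submodule.subset_span ⟨v, hv, rfl⟩))
  have hcomap : ∀ W, colSpace φ p ≤ W →
      ((linPrime p W).map π).comap π = linPrime p W := by
    intro W hW
    rw [Ideal.comap_map_of_surjective' _ hπ, Ideal.mk_ker, sup_eq_left]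
    exact hle W hW
  let F : Submodule p.ResidueField (Fin n → p.ResidueField) → Ideal (MvPolynomial (Fin N) R) :=
    fun W => ((linPrime p W).map π).comap χ
  have hprime : ∀ W, colSpace φ p ≤ W → (F W).IsPrime := by
    intro W hW
    have : ((linPrime p W).map π).IsPrime :=
      Ideal.map_isPrime_of_surjective hπ (by rw [Ideal.mk_ker]; exact hle W hW)
    exact Ideal.comap_isPrime _ _
  have hlt : ∀ W W', colSpace φ p ≤ W → W < W' → F W < F W' := by
    intro W W' hW hWW'
    have h1 : (linPrime p W).map π < (linPrime p W').map π := by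
      refine lt_of_le_of_ne (Ideal.map_mono (linPrime_lt hWW').le) fun heq => ?_
      have := congrArg (Ideal.comap π) heq
      rw [hcomap W hW, hcomap W' (hW.trans hWW'.le)] at this
      exact (linPrime_lt hWW').ne this
    exact lt_of_le_of_ne (Ideal.comap_mono h1.le) fun heq =>
      h1.ne (Ideal.comap_injective_of_surjective χ hχ heq)
  have hFtop : (F ⊤).comap C = p := by
    have h1 : (F ⊤).comap C = (((linPrime p ⊤).map π).comap π).comap C := by
      ext r
      simp only [F, Ideal.mem_comap]
      rw [show χ (C r) = π (C r) from χ.commutes r]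
    rw [h1, hcomap ⊤ le_top, comap_C_linPrime]
  have := hprime _ le_rfl
  have := hprime ⊤ le_top
  have h1 : (rs.length : ℕ∞) ≤ (F (colSpace φ p)).height := by
    refine hrs.length_le_height _ fun r hr => ?_
    have : χ r = 0 := by
      have : Ideal.Quotient.mkₐ R (Ideal.ofList rs) r = 0 :=
        Ideal.Quotient.eq_zero_iff_mem.2 (Ideal.subset_span hr)
      simp only [χ, AlgHom.comp_apply, this, map_zero]
    rw [Ideal.mem_comap, this]
    exact zero_mem _
  have hfin : Module.finrank p.ResidueField (colSpace φ p) ≤ n := by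
    simpa using Submodule.finrank_le (colSpace φ p)
  have h2 := height_add_le_of_strictMono F hprime hlt
    (n - Module.finrank p.ResidueField (colSpace φ p)) le_rfl (le_top (a := colSpace φ p))
    (by rw [finrank_top, Module.finrank_fin_fun]; omega)
  have h3 := MvPolynomial.height_le_height_comap_add (F ⊤)
  rw [hFtop, Nat.card_fin] at h3
  calc ((rs.length + n : ℕ) : ℕ∞) = rs.length +
        (n - Module.finrank p.ResidueField (colSpace φ p) : ℕ) +
          Module.finrank p.ResidueField (colSpace φ p) := by
        norm_cast; omega
    _ ≤ (F (colSpace φ p)).height + (n - Module.finrank p.ResidueField (colSpace φ p) : ℕ) +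
          Module.finrank p.ResidueField (colSpace φ p) := by gcongr
    _ ≤ _ := add_le_add (h2.trans h3) le_rfl

theorem le_idealHeight_of_isRegular [IsNoetherianRing R] [Nontrivial R] [Module.Finite R E]
    {e n s N : ℕ} (hrk : hasRank R E e) (φ : Matrix (Fin n) (Fin s) R)
    (g : (Fin n → R) →ₗ[R] E) (hg : Function.Surjective g)
    (hker : LinearMap.ker g = LinearMap.range φ.mulVecLin)
    {rs : List (MvPolynomial (Fin N) R)} (hrs : RegSeqMod ⊥ rs)
    (ψ : SymmAlgebra R E ≃ₐ[R] (MvPolynomial (Fin N) R ⧸ Ideal.ofList rs)) {i : ℕ} (hi : e ≤ i) :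
    ((i - e + 1 : ℕ) : ℕ∞) ≤ idealHeight (minorsIdeal φ (n - i)) := by
  obtain ⟨q, hq⟩ := associatedPrimes.nonempty R R
  have hqp := IsAssociatedPrime.isPrime hq
  obtain ⟨hfree, hfin⟩ := hrk q hqp hq
  have hN : N ≤ rs.length + e := by
    have hfd : FiniteDimensional q.ResidueField (E →ₗ[R] q.ResidueField) :=
      Module.Finite.equiv (LinearMap.liftBaseChangeEquiv (M := E) (N := q.ResidueField)
        q.ResidueField).symm
    rw [← finrank_linearMap_residueField q hfree hfin]
    exact le_length_add_finrank ψ q.ResidueField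
  refine le_idealHeight_iff.2 fun p _ hp => ?_
  rw [minorsIdeal_le_iff_s8] at hp
  have h1 := le_height_add_finrank_colSpace φ g hg hker hrs ψ p
  obtain ⟨h, hh⟩ : ∃ h : ℕ, p.height = h := by
    refine ENat.ne_top_iff_exists.1 ?_ |>.imp fun _ => Eq.symm
    exact Ideal.height_ne_top_of_isPrime
  rw [hh] at h1 ⊢
  norm_cast at h1 ⊢
  omega

end

/-- For a module of projective dimension at most one over a Cohen-Macaulay local ring,
condition `F_0` holds if and only if the symmetric algebra is a complete intersection,
i.e. a quotient of a polynomial ring over `R` by a regular sequence. -/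
theorem F0_iff_symmetricAlgebra_CI (R E : Type) [CommRing R] [IsLocalRing R]
    [IsNoetherianRing R] (hCM : IsCohenMacaulayLocalRing R)
    [AddCommGroup E] [Module R E] [Module.Finite R E]
    (e : ℕ) (hrk : hasRank R E e)
    (n s : ℕ) (φ : Matrix (Fin n) (Fin s) R) (g : (Fin n → R) →ₗ[R] E)
    (hg : Function.Surjective g)
    (hker : LinearMap.ker g = LinearMap.range φ.mulVecLin)
    (hinj : Function.Injective φ.mulVecLin) :
    (∀ i : ℕ, e ≤ i → ((i - e + 1 : ℕ) : ℕ∞) ≤ idealHeight (minorsIdeal φ (n - i))) ↔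
    (∃ (N : ℕ) (rs : List (MvPolynomial (Fin N) R)),
      RingTheory.Sequence.IsRegular (MvPolynomial (Fin N) R) rs ∧
      Nonempty (SymmAlgebra R E ≃ₐ[R] (MvPolynomial (Fin N) R ⧸ Ideal.ofList rs))) := by
  constructor
  · intro hF
    obtain ⟨rs, hrs, hψ⟩ := exists_isRegular_of_le_idealHeight
      (HeightLEGrade.of_isCohenMacaulay hCM) hrk φ g hg hker hinj hF
    exact ⟨n, rs, hrs, hψ⟩
  · rintro ⟨N, rs, hrs, ⟨ψ⟩⟩ i hi
    exact le_idealHeight_of_isRegular hrk φ g hg hker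
      (regSeqMod_bot_iff.2 hrs.toIsWeaklyRegular) ψ hi
end
end
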